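/- Let K ∈ ℝ, N ∈ [1,∞), let (X,d,m) be a CD*(K,N) metric measure space having the good transport property (GT), let mu, nu ∈ P2(X) with mu << m, and let pi ∈ OptGeo(mu,nu) be the unique optimal geodesic plan from mu to nu. Then (e_t)#pi << m for every t ∈ [0,1). -/

import Mathlib

open MeasureTheory Metric Set unitInterval ENNReal NNReal

noncomputable section

variable {X : Type*} [MetricSpace X]

/-- A constant speed minimizing geodesic parametrized on `[0,1]`. -/
def IsUnitGeodesic (γ : C(unitInterval, X)) : Prop :=
  ∀ s t : unitInterval, dist (γ s) (γ t) = |(s : ℝ) - (t : ℝ)| * dist (γ 0) (γ 1)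

/-- The space of constant speed minimizing geodesics, with the sup distance. -/
def Geo (X : Type*) [MetricSpace X] : Type _ :=
  { γ : C(unitInterval, X) // IsUnitGeodesic γ }

instance : MetricSpace (Geo X) := Subtype.metricSpace
instance : MeasurableSpace (Geo X) := borel _
instance : BorelSpace (Geo X) := ⟨rfl⟩

/-- Evaluation map `e_t`. -/
def eval (t : unitInterval) (γ : Geo X) : X := γ.1 t

/-- `(X,d)` is a geodesic space: any two points are joined by a geodesic. -/
def IsGeodesicSpace (X : Type*) [MetricSpace X] : Prop :=
  ∀ x y : X, ∃ γ : Geo X, eval 0 γ = x ∧ eval 1 γ = y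

/-- The (topological) support of a measure. -/
def measSupport {Y : Type*} [TopologicalSpace Y] [MeasurableSpace Y] (μ : Measure Y) : Set Y :=
  {y | ∀ U ∈ nhds y, 0 < μ U}

variable [MeasurableSpace X]

/-- Finite second moment. -/
def HasFiniteSecondMoment (μ : Measure X) : Prop :=
  ∃ x₀ : X, ∫⁻ x, ENNReal.ofReal (dist x x₀ ^ 2) ∂μ ≠ ⊤

/-- The transport cost of a plan on the space of geodesics. -/
def transportCost (π : Measure (Geo X)) : ℝ≥0∞ :=
  ∫⁻ γ, ENNReal.ofReal (dist (eval 0 γ) (eval 1 γ) ^ 2) ∂π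

/-- `π ∈ OptGeo(μ,ν)`: an optimal geodesic plan from `μ` to `ν`. -/
def IsOptGeo (μ ν : Measure X) (π : Measure (Geo X)) : Prop :=
  IsProbabilityMeasure π ∧ π.map (eval 0) = μ ∧ π.map (eval 1) = ν ∧
    ∀ π' : Measure (Geo X), IsProbabilityMeasure π' →
      π'.map (eval 0) = μ → π'.map (eval 1) = ν →
      transportCost π ≤ transportCost π'

/-- The distortion coefficients `σ_{K,N}^{(t)}(θ)`. -/
def sigmaCoeff (K N t θ : ℝ) : ℝ≥0∞ :=
  if N * Real.pi ^ 2 ≤ K * θ ^ 2 then ⊤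
  else if 0 < K * θ ^ 2 then
    ENNReal.ofReal (Real.sin (t * θ * Real.sqrt (K / N)) / Real.sin (θ * Real.sqrt (K / N)))
  else if K * θ ^ 2 = 0 then ENNReal.ofReal t
  else ENNReal.ofReal (Real.sinh (t * θ * Real.sqrt (-K / N)) / Real.sinh (θ * Real.sqrt (-K / N)))

/-- The distortion coefficients `τ_{K,N}^{(t)}(θ)`. -/
def tauCoeff (K N t θ : ℝ) : ℝ≥0∞ :=
  if N = 1 then
    (if K ≤ 0 then ENNReal.ofReal t else if θ = 0 then ENNReal.ofReal t else ⊤)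
  else ENNReal.ofReal t ^ (1 / N) * sigmaCoeff K (N - 1) t θ ^ ((N - 1) / N)

/-- The (reduced) curvature dimension condition `CD*(K,N)`. -/
def IsCDStar (K N : ℝ) (m : Measure X) : Prop :=
  ∀ μ₀ μ₁ : Measure X, IsProbabilityMeasure μ₀ → IsProbabilityMeasure μ₁ →
    (∃ s : Set X, Bornology.IsBounded s ∧ μ₀ sᶜ = 0 ∧ μ₁ sᶜ = 0) →
    ∃ π : Measure (Geo X), IsOptGeo μ₀ μ₁ π ∧
      ∀ t : unitInterval, ∀ N' : ℝ, N ≤ N' →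
        ∫⁻ γ, (sigmaCoeff K N' (1 - (t : ℝ)) (dist (eval 0 γ) (eval 1 γ)) *
                 ((π.map (eval 0)).rnDeriv m (eval 0 γ)) ^ (-(1 / N')) +
               sigmaCoeff K N' (t : ℝ) (dist (eval 0 γ) (eval 1 γ)) *
                 ((π.map (eval 1)).rnDeriv m (eval 1 γ)) ^ (-(1 / N'))) ∂π
          ≤ ∫⁻ x, ((π.map (eval t)).rnDeriv m x) ^ (1 - 1 / N') ∂m

/-- The good transport property (GT): between absolutely continuous measures in `P₂(X)` there is
a unique optimal geodesic plan, and it is induced by a map from every intermediate time. -/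
def GoodTransport (m : Measure X) : Prop :=
  ∀ μ ν : Measure X, IsProbabilityMeasure μ → IsProbabilityMeasure ν →
    HasFiniteSecondMoment μ → HasFiniteSecondMoment ν → μ ≪ m → ν ≪ m →
    (∃! π : Measure (Geo X), IsOptGeo μ ν π) ∧
    ∀ π : Measure (Geo X), IsOptGeo μ ν π → ∀ t : unitInterval,
      ∃ T : X → Geo X, Measurable T ∧ π = (π.map (eval t)).map T

/-- `c`-concavity (with `c = d²/2`) for functions with values in `ℝ ∪ {-∞}`. -/
def cConcave (φ : X → EReal) : Prop :=
  (∃ x, φ x ≠ ⊥) ∧ (∀ x, φ x ≠ ⊤) ∧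
    ∃ ψ : X → EReal, (∀ y, ψ y ≠ ⊤) ∧
      ∀ x, φ x = ⨅ y, ((dist x y ^ 2 / 2 : ℝ) : EReal) - ψ y

/-- The `c`-transform `φᶜ`. -/
def cTransform (φ : X → EReal) : X → EReal :=
  fun y => ⨅ x, ((dist x y ^ 2 / 2 : ℝ) : EReal) - φ x

/-- The `c`-superdifferential `∂ᶜφ`. -/
def cSuperdiff (φ : X → EReal) : Set (X × X) :=
  {p | φ p.1 + cTransform φ p.2 = ((dist p.1 p.2 ^ 2 / 2 : ℝ) : EReal)}

/-- Kantorovich potential from `μ` to `ν`. -/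
def IsKantorovichPotential (μ ν : Measure X) (φ : X → EReal) : Prop :=
  cConcave φ ∧ ∀ π : Measure (Geo X), IsOptGeo μ ν π →
    measSupport (π.map (fun γ => (eval 0 γ, eval 1 γ))) ⊆ cSuperdiff φ


set_option linter.unusedSectionVars false

theorem continuous_eval' (t : unitInterval) : Continuous (eval t : Geo X → X) := by
  unfold eval
  exact (continuous_eval_const t).comp continuous_subtype_val

theorem measurable_eval' [BorelSpace X] (t : unitInterval) :
    Measurable (eval t : Geo X → X) :=
  (continuous_eval' t).measurable

theorem geo_dist (γ : Geo X) (s t : unitInterval) :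
    dist (eval s γ) (eval t γ) = |(s : ℝ) - (t : ℝ)| * dist (eval 0 γ) (eval 1 γ) :=
  γ.2 s t

/-- affine reparametrization of the unit interval -/
def affI (a b r : unitInterval) : unitInterval :=
  ⟨(1 - (r : ℝ)) * a + r * b, by
    have h1 := r.2.1; have h2 := r.2.2; have h3 := a.2.1; have h4 := a.2.2
    have h5 := b.2.1; have h6 := b.2.2
    constructor <;> nlinarith⟩

theorem continuous_affI (a b : unitInterval) : Continuous (affI a b) := by
  unfold affI
  fun_prop

/-- reparametrized geodesic -/
def reparam (a b : unitInterval) (γ : Geo X) : Geo X :=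
  ⟨γ.1.comp ⟨affI a b, continuous_affI a b⟩, by
    intro s t
    have h1 := γ.2 (affI a b s) (affI a b t)
    have h2 := γ.2 (affI a b 0) (affI a b 1)
    simp only [ContinuousMap.comp_apply, ContinuousMap.coe_mk]
    rw [h1, h2, ← mul_assoc]
    congr 1
    simp only [affI]
    push_cast
    simp
    have : (1 - (s : ℝ)) * a + s * b - ((1 - t) * a + t * b) = (t - s) * (a - b) := by ring
    rw [this, abs_mul, abs_sub_comm (t : ℝ)]⟩

theorem eval_reparam (a b r : unitInterval) (γ : Geo X) :
    eval r (reparam a b γ) = eval (affI a b r) γ := rfl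

theorem continuous_reparam (a b : unitInterval) : Continuous (reparam a b : Geo X → Geo X) := by
  unfold reparam
  refine Continuous.subtype_mk ?_ _
  exact (ContinuousMap.continuous_precomp _).comp continuous_subtype_val

theorem measurable_reparam (a b : unitInterval) :
    Measurable (reparam a b : Geo X → Geo X) :=
  (continuous_reparam a b).measurable

@[simp] theorem affI_zero (a b : unitInterval) : affI a b 0 = a := by
  ext; simp [affI]
@[simp] theorem affI_one (a b : unitInterval) : affI a b 1 = b := by
  ext; simp [affI]

theorem reparam_reparam (a b c d : unitInterval) (γ : Geo X) :
    reparam a b (reparam c d γ) = reparam (affI c d a) (affI c d b) γ := by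
  apply Subtype.ext
  ext r
  change γ.1 _ = γ.1 _
  congr 1
  ext
  simp [affI]
  ring

theorem map_eval_reparam [BorelSpace X] (a b r : unitInterval) (π : Measure (Geo X)) :
    (π.map (reparam a b)).map (eval r) = π.map (eval (affI a b r)) := by
  rw [Measure.map_map (measurable_eval' r) (measurable_reparam a b)]
  rfl

theorem measurable_len [BorelSpace X] [SecondCountableTopology X] :
    Measurable (fun γ : Geo X => dist (eval 0 γ) (eval 1 γ)) :=
  (measurable_eval' 0).dist (measurable_eval' 1)

theorem dist_reparam (a b : unitInterval) (γ : Geo X) :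
    dist (eval 0 (reparam a b γ)) (eval 1 (reparam a b γ)) =
      |(a : ℝ) - b| * dist (eval 0 γ) (eval 1 γ) := by
  rw [eval_reparam, eval_reparam, affI_zero, affI_one, geo_dist]

theorem cost_add (α β : Measure (Geo X)) :
    transportCost (α + β) = transportCost α + transportCost β := by
  simp [transportCost]

theorem cost_smul (c : ℝ≥0∞) (α : Measure (Geo X)) :
    transportCost (c • α) = c * transportCost α := by
  simp [transportCost]

theorem cost_mono {α β : Measure (Geo X)} (h : α ≤ β) : transportCost α ≤ transportCost β :=
  lintegral_mono' h le_rfl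

theorem cost_reparam [BorelSpace X] [SecondCountableTopology X]
    (a b : unitInterval) (π : Measure (Geo X)) :
    transportCost (π.map (reparam a b)) =
      ENNReal.ofReal (((a : ℝ) - b) ^ 2) * transportCost π := by
  unfold transportCost
  rw [lintegral_map _ (measurable_reparam a b), ← lintegral_const_mul]
  · congr 1
    ext γ
    rw [dist_reparam, mul_pow, sq_abs, ENNReal.ofReal_mul (by positivity)]
  · have := measurable_len (X := X)
    fun_prop
  · have := measurable_len (X := X)
    fun_prop

/-- finite optimal plans -/
def FOpt (π : Measure (Geo X)) : Prop :=
  IsFiniteMeasure π ∧ transportCost π ≠ ⊤ ∧ ∀ π' : Measure (Geo X),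
    π'.map (eval 0) = π.map (eval 0) → π'.map (eval 1) = π.map (eval 1) →
      transportCost π ≤ transportCost π'

theorem univ_of_map [BorelSpace X] {α β : Measure (Geo X)} (s t : unitInterval)
    (h : α.map (eval s) = β.map (eval t)) : α univ = β univ := by
  have := congrArg (fun μ => μ univ) h
  simpa [Measure.map_apply (measurable_eval' _)] using this

theorem FOpt.mono [BorelSpace X] {α β : Measure (Geo X)} (h : FOpt β) (hle : α ≤ β) :
    FOpt α := by
  obtain ⟨h1, h2, h3⟩ := h
  have hfin : IsFiniteMeasure α := isFiniteMeasure_of_le β hle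
  refine ⟨hfin, ne_top_of_le_ne_top h2 (cost_mono hle), ?_⟩
  intro π' e0 e1
  have hsub : β - α + α = β := Measure.sub_add_cancel_of_le hle
  have h4 := h3 (β - α + π') (by
    conv_rhs => rw [← hsub]
    rw [Measure.map_add _ _ (measurable_eval' 0), Measure.map_add _ _ (measurable_eval' 0), e0])
    (by
    conv_rhs => rw [← hsub]
    rw [Measure.map_add _ _ (measurable_eval' 1), Measure.map_add _ _ (measurable_eval' 1), e1])
  have hc : transportCost β = transportCost (β - α) + transportCost α := by
    rw [← cost_add, hsub]
  rw [hc, cost_add] at h4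
  have : transportCost (β - α) ≠ ⊤ := by
    intro h; rw [hc, h] at h2; simp at h2
  exact (ENNReal.add_le_add_iff_left this).1 h4

theorem FOpt.replace [BorelSpace X] {α α' β : Measure (Geo X)} (h : FOpt (α + β))
    (e0 : α'.map (eval 0) = α.map (eval 0)) (e1 : α'.map (eval 1) = α.map (eval 1))
    (hc : transportCost α' ≤ transportCost α) : FOpt (α' + β) := by
  obtain ⟨h1, h2, h3⟩ := h
  have hle : transportCost (α' + β) ≤ transportCost (α + β) := by
    rw [cost_add, cost_add]; gcongr
  refine ⟨⟨?_⟩, ne_top_of_le_ne_top h2 hle, ?_⟩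
  · have := univ_of_map 0 0 e0
    have h4 := measure_ne_top (α + β) univ
    rw [Measure.add_apply] at h4 ⊢
    rw [this]
    exact h4.lt_top
  · intro π' f0 f1
    refine hle.trans (h3 π' ?_ ?_)
    · rw [f0, Measure.map_add _ _ (measurable_eval' 0), Measure.map_add _ _ (measurable_eval' 0), e0]
    · rw [f1, Measure.map_add _ _ (measurable_eval' 1), Measure.map_add _ _ (measurable_eval' 1), e1]

theorem FOpt.smul [BorelSpace X] {α : Measure (Geo X)} (h : FOpt α) {c : ℝ≥0∞}
    (hc0 : c ≠ 0) (hc : c ≠ ⊤) : FOpt (c • α) := by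
  obtain ⟨h1, h2, h3⟩ := h
  refine ⟨?_, ?_, ?_⟩
  · exact α.smul_finite hc
  · rw [cost_smul]; exact ENNReal.mul_ne_top hc h2
  · intro π' f0 f1
    have := h3 (c⁻¹ • π') (by
      rw [Measure.map_smul, f0, Measure.map_smul, smul_smul, ENNReal.inv_mul_cancel hc0 hc, one_smul])
      (by
      rw [Measure.map_smul, f1, Measure.map_smul, smul_smul, ENNReal.inv_mul_cancel hc0 hc, one_smul])
    rw [cost_smul] at this
    rw [cost_smul]
    calc c * transportCost α ≤ c * (c⁻¹ * transportCost π') := by gcongr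
      _ = transportCost π' := by
        rw [← mul_assoc, ENNReal.mul_inv_cancel hc0 hc, one_mul]

theorem FOpt.isOptGeo {α : Measure (Geo X)} (h : FOpt α)
    (hp : IsProbabilityMeasure α) : IsOptGeo (α.map (eval 0)) (α.map (eval 1)) α :=
  ⟨hp, rfl, rfl, fun π' _ e0 e1 => h.2.2 π' e0 e1⟩

theorem IsOptGeo.fopt [BorelSpace X] {μ ν : Measure X} {α : Measure (Geo X)}
    (h : IsOptGeo μ ν α) (hc : transportCost α ≠ ⊤) : FOpt α := by
  obtain ⟨h1, h2, h3, h4⟩ := h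
  refine ⟨inferInstance, hc, ?_⟩
  intro π' f0 f1
  refine h4 π' ⟨?_⟩ (f0.trans h2) (f1.trans h3)
  rw [univ_of_map 0 0 f0]; simp

theorem FOpt.rev [BorelSpace X] [SecondCountableTopology X] {α : Measure (Geo X)} (h : FOpt α) :
    FOpt (α.map (reparam 1 0)) := by
  obtain ⟨h1, h2, h3⟩ := h
  have hc : ∀ β : Measure (Geo X), transportCost (β.map (reparam 1 0)) = transportCost β := by
    intro β; rw [cost_reparam]; simp
  refine ⟨inferInstance, by rw [hc]; exact h2, ?_⟩
  intro π' f0 f1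
  rw [map_eval_reparam, affI_zero] at f0
  rw [map_eval_reparam, affI_one] at f1
  rw [hc, ← hc π']
  apply h3
  · rw [map_eval_reparam, affI_zero, f1]
  · rw [map_eval_reparam, affI_one, f0]

/-- the CD inequality for a plan -/
def CDI (K N : ℝ) (m : Measure X) (π : Measure (Geo X)) : Prop :=
  ∀ t : unitInterval, ∀ N' : ℝ, N ≤ N' →
        ∫⁻ γ, (sigmaCoeff K N' (1 - (t : ℝ)) (dist (eval 0 γ) (eval 1 γ)) *
                 ((π.map (eval 0)).rnDeriv m (eval 0 γ)) ^ (-(1 / N')) +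
               sigmaCoeff K N' (t : ℝ) (dist (eval 0 γ) (eval 1 γ)) *
                 ((π.map (eval 1)).rnDeriv m (eval 1 γ)) ^ (-(1 / N'))) ∂π
          ≤ ∫⁻ x, ((π.map (eval t)).rnDeriv m x) ^ (1 - 1 / N') ∂m

theorem exists_cd {K N : ℝ} {m : Measure X} (hCD : IsCDStar K N m) (μ₀ μ₁ : Measure X)
    [IsFiniteMeasure μ₀] (h0 : μ₀ ≠ 0) (hmass : μ₁ univ = μ₀ univ)
    (s : Set X) (hs : Bornology.IsBounded s) (hs0 : μ₀ sᶜ = 0) (hs1 : μ₁ sᶜ = 0) :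
    ∃ η : Measure (Geo X), IsProbabilityMeasure η ∧
      IsOptGeo ((μ₀ univ)⁻¹ • μ₀) ((μ₀ univ)⁻¹ • μ₁) η ∧ CDI K N m η := by
  have hc0 : μ₀ univ ≠ 0 := by simpa using h0
  have hc : μ₀ univ ≠ ⊤ := measure_ne_top _ _
  obtain ⟨π, h1, h2⟩ := hCD ((μ₀ univ)⁻¹ • μ₀) ((μ₀ univ)⁻¹ • μ₁)
    ⟨by simp [ENNReal.inv_mul_cancel hc0 hc]⟩
    ⟨by simp [hmass, ENNReal.inv_mul_cancel hc0 hc]⟩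
    ⟨s, hs, by simp [hs0], by simp [hs1]⟩
  exact ⟨π, h1.1, h1, h2⟩

theorem exists_plan {K N : ℝ} {m : Measure X} (hCD : IsCDStar K N m) (μ₀ μ₁ : Measure X)
    [IsFiniteMeasure μ₀] (hmass : μ₁ univ = μ₀ univ)
    (s : Set X) (hs : Bornology.IsBounded s) (hs0 : μ₀ sᶜ = 0) (hs1 : μ₁ sᶜ = 0) :
    ∃ τ : Measure (Geo X), τ.map (eval 0) = μ₀ ∧ τ.map (eval 1) = μ₁ := by
  by_cases h0 : μ₀ = 0
  · refine ⟨0, by simp [h0], ?_⟩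
    rw [h0] at hmass
    simp at hmass
    simp [hmass]
  · have hc0 : μ₀ univ ≠ 0 := by simpa using h0
    have hc : μ₀ univ ≠ ⊤ := measure_ne_top _ _
    obtain ⟨η, -, h1, -⟩ := exists_cd hCD μ₀ μ₁ h0 hmass s hs hs0 hs1
    refine ⟨μ₀ univ • η, ?_, ?_⟩
    · rw [Measure.map_smul, h1.2.1, smul_smul, ENNReal.mul_inv_cancel hc0 hc, one_smul]
    · rw [Measure.map_smul, h1.2.2.1, smul_smul, ENNReal.mul_inv_cancel hc0 hc, one_smul]

theorem exists_part [Nonempty X] [SecondCountableTopology X] [BorelSpace X] {ε : ℝ} (hε : 0 < ε) :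
    ∃ p : X → ℕ, Measurable p ∧ ∃ c : ℕ → X, ∀ x, dist x (c (p x)) < ε := by
  classical
  have h : ∀ x : X, ∃ n, dist x (TopologicalSpace.denseSeq X n) < ε := fun x =>
    (TopologicalSpace.denseRange_denseSeq X).exists_dist_lt x hε
  refine ⟨fun x => Nat.find (h x), ?_, TopologicalSpace.denseSeq X, fun x => Nat.find_spec (h x)⟩
  apply measurable_find
  intro k
  exact measurableSet_lt (by fun_prop) measurable_const

theorem sum_restrict_fiber {Y ι : Type*} [MeasurableSpace Y] [Countable ι] [MeasurableSpace ι]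
    [MeasurableSingletonClass ι] (Θ : Measure Y) {q : Y → ι} (hq : Measurable q) :
    Measure.sum (fun k => Θ.restrict (q ⁻¹' {k})) = Θ := by
  rw [← Measure.restrict_iUnion]
  · have : (⋃ i, q ⁻¹' {i}) = univ := by ext y; simp
    rw [this, Measure.restrict_univ]
  · intro i j hij
    exact Disjoint.preimage _ (by simpa using hij)
  · intro i; exact hq (measurableSet_singleton i)

theorem approx_plan [Nonempty X] [SecondCountableTopology X] [BorelSpace X]
    {K N : ℝ} {m : Measure X} (hCD : IsCDStar K N m)
    {Y : Type*} [MeasurableSpace Y] (Θ : Measure Y) [IsFiniteMeasure Θ] {f g : Y → X}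
    (hf : Measurable f) (hg : Measurable g) {ε : ℝ} (hε : 0 < ε) :
    ∃ τ : Measure (Geo X), τ.map (eval 0) = Θ.map f ∧ τ.map (eval 1) = Θ.map g ∧
      transportCost τ ≤ ∫⁻ y, ENNReal.ofReal ((dist (f y) (g y) + ε) ^ 2) ∂Θ := by
  obtain ⟨p, hp, c, hc⟩ := exists_part (X := X) (ε := ε / 4) (by positivity)
  let q : Y → ℕ × ℕ := fun y => (p (f y), p (g y))
  have hq : Measurable q := (hp.comp hf).prodMk (hp.comp hg)
  let Θk : ℕ × ℕ → Measure Y := fun k => Θ.restrict (q ⁻¹' {k})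
  have hmeasq : ∀ k, MeasurableSet (q ⁻¹' {k}) := fun k => hq (measurableSet_singleton k)
  have hsum : Measure.sum Θk = Θ := sum_restrict_fiber Θ hq
  have hqk : ∀ k, ∀ᵐ y ∂(Θk k), q y = k := fun k => ae_restrict_mem (hmeasq k)
  have hf0 : ∀ k, ((Θk k).map f) (ball (c k.1) (ε / 4))ᶜ = 0 := by
    intro k
    rw [Measure.map_apply hf measurableSet_ball.compl]
    refine measure_eq_zero_iff_ae_notMem.2 ?_
    filter_upwards [hqk k] with y hy
    simp only [mem_preimage, mem_compl_iff, not_not, mem_ball]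
    have := hc (f y)
    rw [← hy]; exact this
  have hg0 : ∀ k, ((Θk k).map g) (ball (c k.2) (ε / 4))ᶜ = 0 := by
    intro k
    rw [Measure.map_apply hg measurableSet_ball.compl]
    refine measure_eq_zero_iff_ae_notMem.2 ?_
    filter_upwards [hqk k] with y hy
    simp only [mem_preimage, mem_compl_iff, not_not, mem_ball]
    have := hc (g y)
    rw [← hy]; exact this
  have hex : ∀ k, ∃ τ : Measure (Geo X), τ.map (eval 0) = (Θk k).map f ∧
      τ.map (eval 1) = (Θk k).map g := by
    intro k
    refine exists_plan hCD _ _ ?_ (ball (c k.1) (ε / 4) ∪ ball (c k.2) (ε / 4))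
      (isBounded_ball.union isBounded_ball) ?_ ?_
    · rw [Measure.map_apply hf MeasurableSet.univ, Measure.map_apply hg MeasurableSet.univ]
      simp
    · exact measure_mono_null (compl_subset_compl.2 subset_union_left) (hf0 k)
    · exact measure_mono_null (compl_subset_compl.2 subset_union_right) (hg0 k)
  choose τ h0 h1 using hex
  refine ⟨Measure.sum τ, ?_, ?_, ?_⟩
  · rw [Measure.map_sum (measurable_eval' 0).aemeasurable]
    conv_rhs => rw [← hsum, Measure.map_sum hf.aemeasurable]
    simp_rw [h0]
  · rw [Measure.map_sum (measurable_eval' 1).aemeasurable]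
    conv_rhs => rw [← hsum, Measure.map_sum hg.aemeasurable]
    simp_rw [h1]
  · unfold transportCost
    conv_rhs => rw [← hsum]
    rw [lintegral_sum_measure, lintegral_sum_measure]
    refine ENNReal.tsum_le_tsum fun k => ?_
    have hτ0 : ∀ᵐ γ ∂(τ k), eval 0 γ ∈ ball (c k.1) (ε / 4) := by
      have := hf0 k
      rw [← h0, Measure.map_apply (measurable_eval' 0) measurableSet_ball.compl] at this
      filter_upwards [measure_eq_zero_iff_ae_notMem.1 this] with γ hγ
      simpa using hγ
    have hτ1 : ∀ᵐ γ ∂(τ k), eval 1 γ ∈ ball (c k.2) (ε / 4) := by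
      have := hg0 k
      rw [← h1, Measure.map_apply (measurable_eval' 1) measurableSet_ball.compl] at this
      filter_upwards [measure_eq_zero_iff_ae_notMem.1 this] with γ hγ
      simpa using hγ
    have hmass : (τ k) univ = (Θk k) univ := by
      have := congrArg (fun μ => μ univ) (h0 k)
      simpa [Measure.map_apply (measurable_eval' _), Measure.map_apply hf] using this
    calc ∫⁻ γ, ENNReal.ofReal (dist (eval 0 γ) (eval 1 γ) ^ 2) ∂(τ k)
        ≤ ∫⁻ γ, ENNReal.ofReal ((dist (c k.1) (c k.2) + ε / 2) ^ 2) ∂(τ k) := by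
          refine lintegral_mono_ae ?_
          filter_upwards [hτ0, hτ1] with γ a0 a1
          apply ENNReal.ofReal_le_ofReal
          gcongr
          rw [mem_ball] at a0 a1
          have t1 := dist_triangle4 (eval 0 γ) (c k.1) (c k.2) (eval 1 γ)
          rw [dist_comm (c k.2)] at t1
          linarith
      _ = ∫⁻ y, ENNReal.ofReal ((dist (c k.1) (c k.2) + ε / 2) ^ 2) ∂(Θk k) := by
          rw [lintegral_const, lintegral_const, hmass]
      _ ≤ _ := by
          refine lintegral_mono_ae ?_
          filter_upwards [hqk k] with y hy
          apply ENNReal.ofReal_le_ofReal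
          refine pow_le_pow_left₀ (by positivity) ?_ 2
          have b0 := hc (f y)
          have b1 := hc (g y)
          have t1 := dist_triangle4 (c k.1) (f y) (g y) (c k.2)
          rw [← hy] at t1 ⊢
          simp only [q] at t1 ⊢
          rw [dist_comm (c (p (f y))) (f y)] at t1
          linarith

theorem glue_plan [Nonempty X] [SecondCountableTopology X] [BorelSpace X]
    {Y Z : Type*} [MeasurableSpace Y] [MeasurableSpace Z] (Θ₁ : Measure Y) (Θ₂ : Measure Z)
    [IsFiniteMeasure Θ₁] [IsFiniteMeasure Θ₂] {u : Y → X} {v : Z → X}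
    (hu : Measurable u) (hv : Measurable v) (huv : Θ₁.map u = Θ₂.map v) {ε : ℝ} (hε : 0 < ε) :
    ∃ Θ : Measure (Y × Z), Θ.map Prod.fst = Θ₁ ∧ Θ.map Prod.snd = Θ₂ ∧
      ∀ᵐ z ∂Θ, dist (u z.1) (v z.2) < ε := by
  obtain ⟨p, hp, c, hc⟩ := exists_part (X := X) (ε := ε / 2) (by positivity)
  let A : ℕ → Measure Y := fun k => Θ₁.restrict ((p ∘ u) ⁻¹' {k})
  let B : ℕ → Measure Z := fun k => Θ₂.restrict ((p ∘ v) ⁻¹' {k})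
  have hA : Measure.sum A = Θ₁ := sum_restrict_fiber Θ₁ (hp.comp hu)
  have hB : Measure.sum B = Θ₂ := sum_restrict_fiber Θ₂ (hp.comp hv)
  have hAm : ∀ k, MeasurableSet ((p ∘ u) ⁻¹' {k}) :=
    fun k => (hp.comp hu) (measurableSet_singleton k)
  have hBm : ∀ k, MeasurableSet ((p ∘ v) ⁻¹' {k}) :=
    fun k => (hp.comp hv) (measurableSet_singleton k)
  have hAB : ∀ k, A k univ = B k univ := by
    intro k
    simp only [A, B, Measure.restrict_apply MeasurableSet.univ, univ_inter]
    rw [preimage_comp, preimage_comp, ← Measure.map_apply hu (hp (measurableSet_singleton k)),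
      ← Measure.map_apply hv (hp (measurableSet_singleton k)), huv]
  refine ⟨Measure.sum fun k => (A k univ)⁻¹ • (A k).prod (B k), ?_, ?_, ?_⟩
  · rw [Measure.map_sum measurable_fst.aemeasurable]
    conv_rhs => rw [← hA]
    congr 1
    ext1 k
    rw [Measure.map_smul, Measure.map_fst_prod, ← hAB, smul_smul]
    by_cases h : A k univ = 0
    · have : A k = 0 := by simpa using h
      rw [this]; simp
    · rw [ENNReal.inv_mul_cancel h (measure_ne_top _ _), one_smul]
  · rw [Measure.map_sum measurable_snd.aemeasurable]
    conv_rhs => rw [← hB]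
    congr 1
    ext1 k
    rw [Measure.map_smul, Measure.map_snd_prod, smul_smul]
    by_cases h : A k univ = 0
    · have h' : B k univ = 0 := by rw [← hAB, h]
      have : B k = 0 := by simpa using h'
      rw [this]; simp
    · rw [ENNReal.inv_mul_cancel h (measure_ne_top _ _), one_smul]
  · rw [Measure.ae_sum_iff]
    intro k
    refine Measure.ae_smul_measure ?_ _
    have h1 : ∀ᵐ z ∂((A k).prod (B k)), p (u z.1) = k :=
      Measure.quasiMeasurePreserving_fst.ae (ae_restrict_mem (hAm k))
    have h2 : ∀ᵐ z ∂((A k).prod (B k)), p (v z.2) = k :=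
      Measure.quasiMeasurePreserving_snd.ae (ae_restrict_mem (hBm k))
    filter_upwards [h1, h2] with z z1 z2
    have b0 := hc (u z.1)
    have b1 := hc (v z.2)
    rw [z1] at b0; rw [z2] at b1
    have := dist_triangle_right (u z.1) (v z.2) (c k)
    linarith

theorem glue_arith {s a d e A : ℝ} (hs0 : 0 < s) (hs1 : s ≤ 1) (_ha : 0 ≤ a) (_hd : 0 ≤ d)
    (he : 0 < e) (hA0 : 0 ≤ A) (hA : A ≤ a + (1 - s) * d + e) :
    (A + e) ^ 2 ≤ (1 + 2 * e) / s * a ^ 2 + (1 + 2 * e) * (1 - s) * d ^ 2 + (2 * e + 4 * e ^ 2) := by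
  have h1 : (A + e) ^ 2 ≤ (a + (1 - s) * d + 2 * e) ^ 2 := by
    apply pow_le_pow_left₀ (by positivity); linarith
  have h2 : (a + (1 - s) * d) ^ 2 ≤ a ^ 2 / s + (1 - s) * d ^ 2 := by
    obtain ⟨b, rfl⟩ : ∃ b, a = s * b := ⟨a / s, by field_simp⟩
    have : (s * b) ^ 2 / s = s * b ^ 2 := by field_simp
    rw [this]
    nlinarith [mul_nonneg (mul_nonneg hs0.le (sub_nonneg.2 hs1)) (sq_nonneg (b - d))]
  set B := a + (1 - s) * d
  have h3 : (B + 2 * e) ^ 2 ≤ (1 + 2 * e) * B ^ 2 + (2 * e + 4 * e ^ 2) := by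
    nlinarith [mul_nonneg he.le (sq_nonneg (B - 1))]
  have h4 : (1 + 2 * e) * B ^ 2 ≤ (1 + 2 * e) * (a ^ 2 / s + (1 - s) * d ^ 2) := by gcongr
  calc _ ≤ _ := h1
    _ ≤ _ := h3
    _ ≤ (1 + 2 * e) * (a ^ 2 / s + (1 - s) * d ^ 2) + (2 * e + 4 * e ^ 2) := by linarith
    _ = _ := by ring

theorem FOpt.restr0 [Nonempty X] [SecondCountableTopology X] [BorelSpace X]
    {K N : ℝ} {m : Measure X} (hCD : IsCDStar K N m) {π : Measure (Geo X)} (h : FOpt π)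
    {s : unitInterval} (hs : 0 < (s : ℝ)) : FOpt (π.map (reparam 0 s)) := by
  obtain ⟨h1, h2, h3⟩ := h
  have hcr : transportCost (π.map (reparam 0 s)) = ENNReal.ofReal ((s : ℝ) ^ 2) * transportCost π := by
    rw [cost_reparam]; simp
  refine ⟨inferInstance, by rw [hcr]; exact ENNReal.mul_ne_top ENNReal.ofReal_ne_top h2, ?_⟩
  intro π' f0 f1
  rw [map_eval_reparam, affI_zero] at f0
  rw [map_eval_reparam, affI_one] at f1
  by_cases htop : transportCost π' = ⊤
  · rw [htop]; exact le_top
  have hfin' : IsFiniteMeasure π' := ⟨by rw [univ_of_map 0 0 f0]; exact measure_lt_top _ _⟩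
  have key : ∀ e : ℝ, 0 < e → (transportCost π).toReal ≤
      (1 + 2 * e) / s * (transportCost π').toReal +
      (1 + 2 * e) * (1 - s) * (transportCost π).toReal +
      (2 * e + 4 * e ^ 2) * (π univ).toReal := by
    intro e he
    obtain ⟨Θ, g1, g2, g3⟩ := glue_plan π' π (measurable_eval' 1) (measurable_eval' s) f1 he
    have hΘu : Θ univ = π univ := by
      have := congrArg (fun μ => μ univ) g2
      simpa [Measure.map_apply measurable_snd] using this
    have hΘ : IsFiniteMeasure Θ := ⟨by rw [hΘu]; exact measure_lt_top _ _⟩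
    obtain ⟨τ, t0, t1, t2⟩ := approx_plan hCD Θ (f := fun z => eval 0 z.1) (g := fun z => eval 1 z.2)
      ((measurable_eval' 0).comp measurable_fst) ((measurable_eval' 1).comp measurable_snd) he
    have t0' : τ.map (eval 0) = π.map (eval 0) := by
      rw [t0, ← f0, ← g1, Measure.map_map (measurable_eval' 0) measurable_fst]; rfl
    have t1' : τ.map (eval 1) = π.map (eval 1) := by
      conv_rhs => rw [← g2]
      rw [t1, Measure.map_map (measurable_eval' 1) measurable_snd]; rfl
    have hlen := measurable_len (X := X)
    have hl1 : Measurable (fun z : Geo X × Geo X => dist (eval 0 z.1) (eval 1 z.1)) :=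
      hlen.comp measurable_fst
    have hl2 : Measurable (fun z : Geo X × Geo X => dist (eval 0 z.2) (eval 1 z.2)) :=
      hlen.comp measurable_snd
    have c1 : 0 ≤ (1 + 2 * e) / (s : ℝ) := by positivity
    have c2 : 0 ≤ (1 + 2 * e) * (1 - (s : ℝ)) :=
      mul_nonneg (by positivity) (sub_nonneg.2 s.2.2)
    have hbound : transportCost π ≤ ENNReal.ofReal ((1 + 2 * e) / s) * transportCost π' +
        ENNReal.ofReal ((1 + 2 * e) * (1 - s)) * transportCost π +
        ENNReal.ofReal (2 * e + 4 * e ^ 2) * π univ := by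
      calc transportCost π ≤ transportCost τ := h3 τ t0' t1'
        _ ≤ _ := t2
        _ ≤ ∫⁻ z, (ENNReal.ofReal ((1 + 2 * e) / s) *
              ENNReal.ofReal (dist (eval 0 z.1) (eval 1 z.1) ^ 2) +
            ENNReal.ofReal ((1 + 2 * e) * (1 - s)) *
              ENNReal.ofReal (dist (eval 0 z.2) (eval 1 z.2) ^ 2) +
            ENNReal.ofReal (2 * e + 4 * e ^ 2)) ∂Θ := by
          refine lintegral_mono_ae ?_
          filter_upwards [g3] with z hz
          rw [← ENNReal.ofReal_mul c1, ← ENNReal.ofReal_mul c2,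
            ← ENNReal.ofReal_add (by positivity) (mul_nonneg c2 (by positivity)),
            ← ENNReal.ofReal_add (add_nonneg (by positivity) (mul_nonneg c2 (by positivity)))
              (by positivity)]
          apply ENNReal.ofReal_le_ofReal
          refine glue_arith hs s.2.2 dist_nonneg dist_nonneg he dist_nonneg ?_
          have d1 := dist_triangle4 (eval 0 z.1) (eval 1 z.1) (eval s z.2) (eval 1 z.2)
          have d2 := geo_dist z.2 s 1
          rw [abs_sub_comm] at d2
          have : |((1 : unitInterval) : ℝ) - s| = 1 - s := by
            rw [abs_of_nonneg]; simp; simpa using s.2.2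
          rw [this] at d2
          linarith
        _ = _ := by
          rw [lintegral_add_right _ measurable_const, lintegral_const, hΘu,
            lintegral_add_left (by fun_prop), lintegral_const_mul _ (by fun_prop),
            lintegral_const_mul _ (by fun_prop)]
          unfold transportCost
          conv_rhs => rw [← g1]
          rw [lintegral_map (by fun_prop) measurable_fst]
          congr 3
          conv_rhs => rw [← g2]
          rw [lintegral_map (by fun_prop) measurable_snd]
    have := ENNReal.toReal_mono (by
      simp only [ne_eq, ENNReal.add_eq_top, not_or]
      exact ⟨⟨ENNReal.mul_ne_top ENNReal.ofReal_ne_top htop,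
        ENNReal.mul_ne_top ENNReal.ofReal_ne_top h2⟩,
        ENNReal.mul_ne_top ENNReal.ofReal_ne_top (measure_ne_top _ _)⟩) hbound
    rw [ENNReal.toReal_add, ENNReal.toReal_add, ENNReal.toReal_mul, ENNReal.toReal_mul,
      ENNReal.toReal_mul, ENNReal.toReal_ofReal c1, ENNReal.toReal_ofReal c2,
      ENNReal.toReal_ofReal (by positivity)] at this
    · exact this
    · exact ENNReal.mul_ne_top ENNReal.ofReal_ne_top htop
    · exact ENNReal.mul_ne_top ENNReal.ofReal_ne_top h2
    · exact ENNReal.add_ne_top.2 ⟨ENNReal.mul_ne_top ENNReal.ofReal_ne_top htop,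
        ENNReal.mul_ne_top ENNReal.ofReal_ne_top h2⟩
    · exact ENNReal.mul_ne_top ENNReal.ofReal_ne_top (measure_ne_top _ _)
  have lim : (transportCost π).toReal ≤
      (1 + 2 * 0) / s * (transportCost π').toReal +
      (1 + 2 * 0) * (1 - s) * (transportCost π).toReal +
      (2 * 0 + 4 * 0 ^ 2) * (π univ).toReal := by
    have hcont : Continuous (fun e : ℝ => (1 + 2 * e) / s * (transportCost π').toReal +
      (1 + 2 * e) * (1 - s) * (transportCost π).toReal +
      (2 * e + 4 * e ^ 2) * (π univ).toReal) := by fun_prop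
    have ht := (hcont.tendsto 0).mono_left (nhdsWithin_le_nhds (s := Ioi (0 : ℝ)))
    refine ge_of_tendsto ht ?_
    filter_upwards [self_mem_nhdsWithin] with e he using key e he
  rw [hcr]
  set C := (transportCost π).toReal
  set C' := (transportCost π').toReal
  have hfinal : (s : ℝ) ^ 2 * C ≤ C' := by
    have : (s : ℝ) * C ≤ C' / s := by
      have e1 : (1 + 2 * 0) / (s : ℝ) * C' = C' / s := by ring
      rw [e1] at lim
      linarith
    rw [le_div_iff₀ hs] at this
    nlinarith
  rw [← ENNReal.ofReal_toReal h2, ← ENNReal.ofReal_toReal htop, ← ENNReal.ofReal_mul (by positivity)]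
  exact ENNReal.ofReal_le_ofReal hfinal

theorem FOpt.back [Nonempty X] [SecondCountableTopology X] [BorelSpace X]
    {K N : ℝ} {m : Measure X} (hCD : IsCDStar K N m) {π : Measure (Geo X)} (h : FOpt π)
    {s : unitInterval} (hs : 0 < (s : ℝ)) : FOpt (π.map (reparam s 0)) := by
  have := (h.restr0 hCD hs).rev
  rw [Measure.map_map (measurable_reparam _ _) (measurable_reparam _ _)] at this
  convert this using 2
  ext1 γ
  simp [reparam_reparam]

theorem FOpt.restr1 [Nonempty X] [SecondCountableTopology X] [BorelSpace X]
    {K N : ℝ} {m : Measure X} (hCD : IsCDStar K N m) {π : Measure (Geo X)} (h : FOpt π)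
    {s : unitInterval} (hs : (s : ℝ) < 1) : FOpt (π.map (reparam s 1)) := by
  have := (h.rev.back hCD (s := unitInterval.symm s) (by simpa using hs))
  rw [Measure.map_map (measurable_reparam _ _) (measurable_reparam _ _)] at this
  convert this using 2
  ext1 γ
  simp [reparam_reparam]
  congr 1
  ext
  simp [affI]

theorem measurable_sigma (K N t : ℝ) : Measurable (fun θ : ℝ => sigmaCoeff K N t θ) := by
  unfold sigmaCoeff
  refine Measurable.ite (measurableSet_le (by fun_prop) (by fun_prop)) measurable_const ?_
  refine Measurable.ite (measurableSet_lt (by fun_prop) (by fun_prop)) ?_ ?_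
  · refine ENNReal.measurable_ofReal.comp (Measurable.div ?_ ?_)
    · exact Real.measurable_sin.comp (by fun_prop)
    · exact Real.measurable_sin.comp (by fun_prop)
  refine Measurable.ite (measurableSet_eq_fun (by fun_prop) (by fun_prop)) measurable_const ?_
  refine ENNReal.measurable_ofReal.comp (Measurable.div ?_ ?_)
  · exact Real.measurable_sinh.comp (by fun_prop)
  · exact Real.measurable_sinh.comp (by fun_prop)

theorem sin_arg {K N θ : ℝ} (hN : 0 < N) (hθ : 0 ≤ θ) (h1 : ¬ N * Real.pi ^ 2 ≤ K * θ ^ 2)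
    (h2 : 0 < K * θ ^ 2) :
    0 < θ * Real.sqrt (K / N) ∧ θ * Real.sqrt (K / N) < Real.pi := by
  have hθ0 : 0 < θ := by
    rcases hθ.lt_or_eq with h | h
    · exact h
    · rw [← h] at h2; simp at h2
  have hK : 0 < K := by
    by_contra hk
    have : K * θ ^ 2 ≤ 0 := mul_nonpos_of_nonpos_of_nonneg (not_lt.1 hk) (by positivity)
    linarith
  refine ⟨by positivity, ?_⟩
  have hsq : (θ * Real.sqrt (K / N)) ^ 2 < Real.pi ^ 2 := by
    rw [mul_pow, Real.sq_sqrt (by positivity)]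
    rw [not_le] at h1
    have : θ ^ 2 * (K / N) = K * θ ^ 2 / N := by ring
    rw [this, div_lt_iff₀ hN]
    linarith
  exact lt_of_pow_lt_pow_left₀ 2 Real.pi_pos.le hsq

theorem sinh_arg {K N θ : ℝ} (hN : 0 < N) (hθ : 0 ≤ θ) 
    (h2 : ¬ 0 < K * θ ^ 2) (h3 : ¬ K * θ ^ 2 = 0) :
    K < 0 ∧ 0 < θ * Real.sqrt (-K / N) := by
  have hθ0 : 0 < θ := by
    rcases hθ.lt_or_eq with h | h
    · exact h
    · rw [← h] at h3; simp at h3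
  have hK : K < 0 := by
    by_contra hk
    rcases (not_lt.1 hk).lt_or_eq with h | h
    · exact h2 (by positivity)
    · rw [← h] at h3; simp at h3
  have : 0 < -K / N := div_pos (by linarith) hN
  exact ⟨hK, by positivity⟩

theorem sigma_pos {K N t θ : ℝ} (hN : 0 < N) (ht : 0 < t) (ht1 : t ≤ 1) (hθ : 0 ≤ θ) :
    0 < sigmaCoeff K N t θ := by
  unfold sigmaCoeff
  split_ifs with h1 h2 h3
  · simp
  · obtain ⟨a, b⟩ := sin_arg hN hθ h1 h2
    rw [ENNReal.ofReal_pos, mul_assoc]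
    refine div_pos (Real.sin_pos_of_pos_of_lt_pi (by positivity) ?_)
      (Real.sin_pos_of_pos_of_lt_pi a b)
    nlinarith
  · simpa using ht
  · obtain ⟨_, a⟩ := sinh_arg hN hθ h2 h3
    rw [ENNReal.ofReal_pos, mul_assoc]
    exact div_pos (Real.sinh_pos_iff.2 (by positivity)) (Real.sinh_pos_iff.2 a)

theorem sinh_ratio {r x : ℝ} (hr0 : 0 ≤ r) (hr1 : r ≤ 1) (hx : 0 < x) :
    1 - r * Real.cosh x ≤ Real.sinh ((1 - r) * x) / Real.sinh x := by
  have hs : 0 < Real.sinh x := Real.sinh_pos_iff.2 hx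
  rw [le_div_iff₀ hs]
  have hmv : Real.sinh x - Real.sinh ((1 - r) * x) ≤ Real.cosh x * (x - (1 - r) * x) := by
    refine Convex.image_sub_le_mul_sub_of_deriv_le (convex_Icc 0 x)
      Real.continuous_sinh.continuousOn Real.differentiable_sinh.differentiableOn ?_ _ ?_ _ ?_ ?_
    · intro y hy
      rw [interior_Icc] at hy
      rw [Real.deriv_sinh]
      rw [Real.cosh_le_cosh, abs_of_pos hy.1, abs_of_pos hx]
      exact hy.2.le
    · constructor <;> nlinarith
    · exact ⟨hx.le, le_rfl⟩
    · nlinarith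
  have hxs : x ≤ Real.sinh x := Real.self_le_sinh_iff.2 hx.le
  have : Real.cosh x * (x - (1 - r) * x) ≤ r * Real.cosh x * Real.sinh x := by
    have : Real.cosh x * (x - (1 - r) * x) = r * Real.cosh x * x := by ring
    rw [this]
    have := Real.cosh_pos x
    gcongr
  linarith

theorem sigma_ge {K N r θ L : ℝ} (hN : 0 < N) (hr0 : 0 ≤ r) (hr1 : r ≤ 1) (hθ : 0 ≤ θ)
    (hL : θ ≤ L) :
    ENNReal.ofReal (1 - r * Real.cosh (L * Real.sqrt (|K| / N))) ≤ sigmaCoeff K N (1 - r) θ := by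
  have hcosh := Real.one_le_cosh (L * Real.sqrt (|K| / N))
  have hbase : 1 - r * Real.cosh (L * Real.sqrt (|K| / N)) ≤ 1 - r := by nlinarith
  unfold sigmaCoeff
  split_ifs with h1 h2 h3
  · simp
  · obtain ⟨a, b⟩ := sin_arg hN hθ h1 h2
    apply ENNReal.ofReal_le_ofReal
    refine hbase.trans ?_
    rw [mul_assoc, le_div_iff₀ (Real.sin_pos_of_pos_of_lt_pi a b)]
    have := strictConcaveOn_sin_Icc.concaveOn.2
      (⟨le_rfl, Real.pi_pos.le⟩ : (0:ℝ) ∈ Icc 0 Real.pi)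
      (⟨a.le, b.le⟩ : θ * Real.sqrt (K/N) ∈ Icc 0 Real.pi) hr0 (sub_nonneg.2 hr1)
      (by ring : r + (1-r) = 1)
    simpa using this
  · exact ENNReal.ofReal_le_ofReal hbase
  · obtain ⟨hK, a⟩ := sinh_arg hN hθ h2 h3
    apply ENNReal.ofReal_le_ofReal
    rw [mul_assoc]
    refine le_trans ?_ (sinh_ratio hr0 hr1 a)
    have : Real.cosh (θ * Real.sqrt (-K / N)) ≤ Real.cosh (L * Real.sqrt (|K| / N)) := by
      rw [abs_of_neg hK, Real.cosh_le_cosh, abs_of_pos a, abs_of_nonneg]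
      · gcongr
      · have : 0 ≤ L := hθ.trans hL
        positivity
    have := mul_le_mul_of_nonneg_left this hr0
    linarith

/-- uniformly bounded plans -/
def Bd (x₀ : X) (R : ℝ) (π : Measure (Geo X)) : Prop :=
  ∀ᵐ γ ∂π, ∀ r, dist (eval r γ) x₀ ≤ R

theorem Bd.ac {x₀ : X} {R : ℝ} {α β : Measure (Geo X)} (h : Bd x₀ R β) (hle : α ≪ β) :
    Bd x₀ R α := hle.ae_le h

theorem Bd.mono {x₀ : X} {R : ℝ} {α β : Measure (Geo X)} (h : Bd x₀ R β) (hle : α ≤ β) :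
    Bd x₀ R α := h.ac (Measure.absolutelyContinuous_of_le hle)

theorem Bd.add {x₀ : X} {R : ℝ} {α β : Measure (Geo X)} (h : Bd x₀ R α) (h' : Bd x₀ R β) :
    Bd x₀ R (α + β) := by
  unfold Bd at *
  rw [ae_add_measure_iff]
  exact ⟨h, h'⟩

theorem Bd.map [BorelSpace X] {x₀ : X} {R : ℝ} {α : Measure (Geo X)} (h : Bd x₀ R α)
    (a b : unitInterval) : Bd x₀ R (α.map (reparam a b)) := by
  unfold Bd at *
  rw [ae_map_iff (measurable_reparam a b).aemeasurable]
  · filter_upwards [h] with γ hγ r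
    rw [eval_reparam]; exact hγ _
  · have : IsClosed {γ : Geo X | ∀ r, dist (eval r γ) x₀ ≤ R} := by
      simp only [Set.ofPred_forall]
      refine isClosed_iInter fun r => isClosed_le ((continuous_eval' r).dist continuous_const)
        continuous_const
    exact this.measurableSet

theorem Bd.null [BorelSpace X] {x₀ : X} {R : ℝ} {α : Measure (Geo X)} (h : Bd x₀ R α)
    (r : unitInterval) : (α.map (eval r)) (closedBall x₀ R)ᶜ = 0 := by
  rw [Measure.map_apply (measurable_eval' r) measurableSet_closedBall.compl]
  refine measure_eq_zero_iff_ae_notMem.2 ?_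
  filter_upwards [h] with γ hγ
  simpa using hγ r

theorem Bd.len {x₀ : X} {R : ℝ} {α : Measure (Geo X)} (h : Bd x₀ R α) :
    ∀ᵐ γ ∂α, dist (eval 0 γ) (eval 1 γ) ≤ 2 * R := by
  filter_upwards [h] with γ hγ
  have := dist_triangle_right (eval 0 γ) (eval 1 γ) x₀
  have h0 := hγ 0
  have h1 := hγ 1
  linarith

theorem Bd.of_ends [BorelSpace X] {x₀ : X} {R : ℝ} {α : Measure (Geo X)}
    (h0 : (α.map (eval 0)) (closedBall x₀ R)ᶜ = 0)
    (h1 : (α.map (eval 1)) (closedBall x₀ R)ᶜ = 0) : Bd x₀ (3 * R) α := by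
  rw [Measure.map_apply (measurable_eval' _) measurableSet_closedBall.compl] at h0 h1
  unfold Bd
  filter_upwards [measure_eq_zero_iff_ae_notMem.1 h0, measure_eq_zero_iff_ae_notMem.1 h1]
    with γ a0 a1 r
  simp at a0 a1
  have t1 := dist_triangle_right (eval 0 γ) (eval 1 γ) x₀
  have t2 := dist_triangle (eval r γ) (eval 0 γ) x₀
  have t3 := geo_dist γ r 0
  have : |(r : ℝ) - ((0 : unitInterval) : ℝ)| ≤ 1 := by
    simp only [Icc.coe_zero, sub_zero]; rw [abs_of_nonneg r.2.1]; exact r.2.2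
  have t4 : dist (eval r γ) (eval 0 γ) ≤ dist (eval 0 γ) (eval 1 γ) := by
    rw [t3]; exact mul_le_of_le_one_left dist_nonneg this
  linarith

theorem Bd.moment [BorelSpace X] {x₀ : X} {R : ℝ} {α : Measure (Geo X)} [IsFiniteMeasure α]
    (h : Bd x₀ R α) (r : unitInterval) : HasFiniteSecondMoment (α.map (eval r)) := by
  refine ⟨x₀, ?_⟩
  rw [lintegral_map (by fun_prop) (measurable_eval' r)]
  refine ne_top_of_le_ne_top (b := ∫⁻ γ, ENNReal.ofReal (R ^ 2) ∂α) ?_ (lintegral_mono_ae ?_)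
  · rw [lintegral_const]
    exact ENNReal.mul_ne_top ENNReal.ofReal_ne_top (measure_ne_top _ _)
  · filter_upwards [h] with γ hγ
    apply ENNReal.ofReal_le_ofReal
    exact pow_le_pow_left₀ dist_nonneg (hγ r) 2

theorem Bd.cost {x₀ : X} {R : ℝ} {α : Measure (Geo X)} [IsFiniteMeasure α]
    (h : Bd x₀ R α) : transportCost α ≠ ⊤ := by
  refine ne_top_of_le_ne_top (b := ∫⁻ γ, ENNReal.ofReal ((2 * R) ^ 2) ∂α) ?_ (lintegral_mono_ae ?_)
  · rw [lintegral_const]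
    exact ENNReal.mul_ne_top ENNReal.ofReal_ne_top (measure_ne_top _ _)
  · filter_upwards [h.len] with γ hγ
    apply ENNReal.ofReal_le_ofReal
    exact pow_le_pow_left₀ dist_nonneg hγ 2

theorem CDI.pos [SecondCountableTopology X] [BorelSpace X] {K N : ℝ} {m : Measure X}
    (hN : 1 ≤ N) {η : Measure (Geo X)} [IsProbabilityMeasure η] (h : CDI K N m η)
    (hac : η.map (eval 0) ≪ m) {s : unitInterval} (hs : (s : ℝ) < 1) :
    ¬ (η.map (eval s)) ⟂ₘ m := by
  intro hsing
  have h1 := h s (N + 1) (by linarith)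
  have hz : ∫⁻ x, ((η.map (eval s)).rnDeriv m x) ^ (1 - 1 / (N + 1)) ∂m = 0 := by
    rw [lintegral_eq_zero_iff (by
      exact (Measure.measurable_rnDeriv _ _).pow_const _)]
    filter_upwards [hsing.rnDeriv_ae_eq_zero] with x hx
    rw [hx]
    simp only [Pi.zero_apply]
    apply ENNReal.zero_rpow_of_pos
    have : 1 / (N + 1) < 1 := by
      rw [div_lt_one (by linarith)]; linarith
    linarith
  rw [hz, nonpos_iff_eq_zero] at h1
  have hlen := measurable_len (X := X)
  have hsg : ∀ t, Measurable (fun γ : Geo X =>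
      sigmaCoeff K (N + 1) t (dist (eval 0 γ) (eval 1 γ))) :=
    fun t => (measurable_sigma K (N + 1) t).comp hlen
  have hrn : ∀ t, Measurable (fun γ : Geo X =>
      ((η.map (eval t)).rnDeriv m (eval t γ)) ^ (-(1 / (N + 1)))) :=
    fun t => ((Measure.measurable_rnDeriv _ _).comp (measurable_eval' t)).pow_const _
  replace h1 := (lintegral_eq_zero_iff (by
    exact ((hsg _).mul (hrn 0)).add ((hsg _).mul (hrn 1)))).1 h1
  have h2 : ∀ᵐ γ ∂η, (η.map (eval 0)).rnDeriv m (eval 0 γ) < ⊤ :=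
    ae_of_ae_map (measurable_eval' 0).aemeasurable
      (hac.ae_le (Measure.rnDeriv_lt_top (η.map (eval 0)) m))
  obtain ⟨γ, a, b⟩ := (h1.and h2).exists
  simp only [Pi.zero_apply, add_eq_zero, mul_eq_zero] at a
  rcases a.1 with a | a
  · have := sigma_pos (K := K) (N := N + 1) (t := 1 - (s : ℝ)) (by linarith) (by linarith)
      (by have := s.2.1; linarith) (dist_nonneg (x := eval 0 γ) (y := eval 1 γ))
    exact this.ne' a
  · rw [ENNReal.rpow_eq_zero_iff] at a
    rcases a with ⟨_, a⟩ | ⟨a, _⟩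
    · have : 0 < 1 / (N + 1) := by positivity
      linarith
    · exact b.ne a

structure Hyp (K N : ℝ) (m : Measure X) : Prop where
  hN : 1 ≤ N
  hCD : IsCDStar K N m
  hGT : GoodTransport m
  hfin : ∀ x R, m (closedBall x R) ≠ ⊤

section P5
variable [Nonempty X] [SecondCountableTopology X] [BorelSpace X] {K N : ℝ} {m : Measure X}

theorem Hyp.sf (H : Hyp K N m) : SigmaFinite m := by
  obtain ⟨x₀⟩ := ‹Nonempty X›
  refine ⟨⟨⟨fun n : ℕ => closedBall x₀ n, fun _ => trivial,
    fun n => lt_top_iff_ne_top.2 (H.hfin _ _), ?_⟩⟩⟩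
  exact iUnion_closedBall_nat x₀

theorem Hyp.cdi (H : Hyp K N m) {ω : Measure (Geo X)} (h : FOpt ω) (h0 : ω ≠ 0) {x₀ : X} {R : ℝ}
    (hb : Bd x₀ R ω) (a0 : ω.map (eval 0) ≪ m) (a1 : ω.map (eval 1) ≪ m) :
    IsProbabilityMeasure ((ω univ)⁻¹ • ω) ∧ CDI K N m ((ω univ)⁻¹ • ω) := by
  have := h.1
  have hu : ω univ ≠ 0 := by simpa using h0
  have hut : ω univ ≠ ⊤ := measure_ne_top _ _
  have hp : IsProbabilityMeasure ((ω univ)⁻¹ • ω) := ⟨by simp [ENNReal.inv_mul_cancel hu hut]⟩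
  refine ⟨hp, ?_⟩
  have hmu : ∀ t, (ω.map (eval t)) univ = ω univ := fun t => by
    rw [Measure.map_apply (measurable_eval' t) MeasurableSet.univ]; simp
  have hne : ω.map (eval 0) ≠ 0 := by
    intro hh
    apply hu
    rw [← hmu 0, hh]; simp
  obtain ⟨η, hη, ho, hc⟩ := exists_cd H.hCD (ω.map (eval 0)) (ω.map (eval 1)) hne
    ((hmu 1).trans (hmu 0).symm) (closedBall x₀ R) isBounded_closedBall (hb.null 0) (hb.null 1)
  rw [hmu 0] at ho
  have ho' := (h.smul (ENNReal.inv_ne_zero.2 hut) (ENNReal.inv_ne_top.2 hu)).isOptGeo hp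
  have hb' : Bd x₀ R ((ω univ)⁻¹ • ω) := hb.ac Measure.smul_absolutelyContinuous
  have m0 := hb'.moment 0
  have m1 := hb'.moment 1
  have p0 : IsProbabilityMeasure (((ω univ)⁻¹ • ω).map (eval 0)) :=
    Measure.isProbabilityMeasure_map (measurable_eval' 0).aemeasurable
  have p1 : IsProbabilityMeasure (((ω univ)⁻¹ • ω).map (eval 1)) :=
    Measure.isProbabilityMeasure_map (measurable_eval' 1).aemeasurable
  rw [← Measure.map_smul, ← Measure.map_smul] at ho
  have := (H.hGT _ _ p0 p1 m0 m1
    (by rw [Measure.map_smul]; exact Measure.smul_absolutelyContinuous.trans a0)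
    (by rw [Measure.map_smul]; exact Measure.smul_absolutelyContinuous.trans a1)).1.unique ho ho'
  rwa [← this]

theorem map_restrict_eval (ω : Measure (Geo X)) (r : unitInterval) {A : Set X}
    (hA : MeasurableSet A) :
    (ω.restrict (eval r ⁻¹' A)).map (eval r) = (ω.map (eval r)).restrict A :=
  (Measure.restrict_map (measurable_eval' r) hA).symm

theorem Hyp.ac (H : Hyp K N m) {ω : Measure (Geo X)} (h : FOpt ω) {x₀ : X} {R : ℝ}
    (hb : Bd x₀ R ω) (a0 : ω.map (eval 0) ≪ m) (a1 : ω.map (eval 1) ≪ m) (r : unitInterval) :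
    ω.map (eval r) ≪ m := by
  by_cases hr : (r : ℝ) = 1
  · have : r = 1 := by ext; simpa using hr
    rw [this]; exact a1
  have hr1 : (r : ℝ) < 1 := lt_of_le_of_ne r.2.2 hr
  refine Measure.AbsolutelyContinuous.mk fun A hA hmA => ?_
  by_contra hpos
  set ω' := ω.restrict (eval r ⁻¹' A) with hω'
  have hle : ω' ≤ ω := Measure.restrict_le_self
  have hac : ∀ t, ω'.map (eval t) ≪ ω.map (eval t) := fun t =>
    Measure.absolutelyContinuous_of_le (Measure.map_mono hle (measurable_eval' t))
  have h0 : ω' ≠ 0 := by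
    intro hh
    apply hpos
    have := congrArg (fun μ => μ univ) hh
    simp only [hω', Measure.restrict_apply_univ, Measure.coe_zero, Pi.zero_apply] at this
    rwa [Measure.map_apply (measurable_eval' r) hA]
  obtain ⟨hp, hc⟩ := H.cdi (h.mono hle) h0 (hb.mono hle) ((hac 0).trans a0) ((hac 1).trans a1)
  refine hc.pos H.hN ?_ hr1 ?_
  · rw [Measure.map_smul]
    exact Measure.smul_absolutelyContinuous.trans ((hac 0).trans a0)
  · rw [Measure.map_smul]
    refine Measure.MutuallySingular.smul _ ?_
    rw [hω', map_restrict_eval _ _ hA]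
    refine ⟨Aᶜ, hA.compl, ?_, by rwa [compl_compl]⟩
    rw [Measure.restrict_apply hA.compl]; simp

theorem equalize {Y : Type*} [MeasurableSpace Y] {β : Measure Y} [IsFiniteMeasure β]
    {μ : Measure X} {f : Y → X} (hf : Measurable f) (h : μ ≤ β.map f) :
    ∃ β' ≤ β, β'.map f = μ := by
  have hfin : IsFiniteMeasure μ := isFiniteMeasure_of_le _ h
  set g := μ.rnDeriv (β.map f) with hg
  have hgm : Measurable g := Measure.measurable_rnDeriv _ _
  refine ⟨β.withDensity (g ∘ f), ?_, ?_⟩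
  · have h1 : ∀ᵐ y ∂β, (g ∘ f) y ≤ 1 :=
      ae_of_ae_map hf.aemeasurable (Measure.rnDeriv_le_one_of_le h)
    calc β.withDensity (g ∘ f) ≤ β.withDensity 1 := withDensity_mono h1
      _ = β := withDensity_one
  · have h2 := Measure.withDensity_rnDeriv_eq μ (β.map f) (Measure.absolutelyContinuous_of_le h)
    rw [← h2]
    ext s hs
    rw [Measure.map_apply hf hs, withDensity_apply _ (hf hs), withDensity_apply _ hs,
      setLIntegral_map hs hgm hf]
    rfl

theorem split_ac (ξ : Measure X) [IsFiniteMeasure ξ] [SigmaFinite m] (h : ¬ ξ ⟂ₘ m) :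
    ∃ S, MeasurableSet S ∧ ξ S ≠ 0 ∧ ξ.restrict S ≪ m := by
  obtain ⟨S, hS, h1, h2⟩ := Measure.mutuallySingular_singularPart ξ m
  refine ⟨S, hS, fun h0 => h ⟨S, hS, h0, h2⟩, ?_⟩
  refine Measure.AbsolutelyContinuous.mk fun A hA hmA => ?_
  rw [Measure.restrict_apply hA]
  rw [Measure.haveLebesgueDecomposition_add ξ m, Measure.add_apply]
  rw [measure_mono_null inter_subset_right h1, zero_add]
  exact withDensity_absolutelyContinuous _ _ (measure_mono_null inter_subset_left hmA)

theorem Hyp.J (H : Hyp K N m) {α β : Measure (Geo X)} (hα : α ≠ 0) (h : FOpt (α + β))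
    (he : α.map (eval 0) = β.map (eval 0)) (a0 : α.map (eval 0) ≪ m) {x₀ : X} {R : ℝ}
    (hb : Bd x₀ R α) {s : unitInterval} (hs : (s : ℝ) < 1) :
    ∃ α' β' : Measure (Geo X), α' ≠ 0 ∧ FOpt (α' + β') ∧ α'.map (eval 0) = β'.map (eval 0) ∧
      α'.map (eval 0) ≤ α.map (eval 0) ∧ α'.map (eval 1) ≤ α.map (eval 1) ∧ β' ≤ β ∧
      α'.map (eval s) ≪ m ∧ Bd x₀ (3 * R) α' := by
  have := H.sf
  have hfα : FOpt α := h.mono (Measure.le_add_right le_rfl)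
  have hfβ : FOpt β := h.mono (Measure.le_add_left le_rfl)
  have := hfα.1
  have := hfβ.1
  have hu : α univ ≠ 0 := by simpa using hα
  have hut : α univ ≠ ⊤ := measure_ne_top _ _
  have hmu : ∀ t, (α.map (eval t)) univ = α univ := fun t => by
    rw [Measure.map_apply (measurable_eval' t) MeasurableSet.univ]; simp
  have hne : α.map (eval 0) ≠ 0 := by
    intro hh
    apply hu
    rw [← hmu 0, hh]; simp
  obtain ⟨η, hη, ho, hc⟩ := exists_cd H.hCD (α.map (eval 0)) (α.map (eval 1)) hne
    ((hmu 1).trans (hmu 0).symm) (closedBall x₀ R) isBounded_closedBall (hb.null 0) (hb.null 1)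
  rw [hmu 0] at ho
  set c := α univ
  obtain ⟨_, o0, o1, o2⟩ := ho
  have hη0 : η.map (eval 0) ≪ m := by
    rw [o0]; exact Measure.smul_absolutelyContinuous.trans a0
  have hns := hc.pos H.hN hη0 hs
  obtain ⟨S, hS, hS0, hSac⟩ := split_ac _ hns
  have e0 : (c • η).map (eval 0) = α.map (eval 0) := by
    rw [Measure.map_smul, o0, smul_smul, ENNReal.mul_inv_cancel hu hut, one_smul]
  have e1 : (c • η).map (eval 1) = α.map (eval 1) := by
    rw [Measure.map_smul, o1, smul_smul, ENNReal.mul_inv_cancel hu hut, one_smul]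
  have hcost : transportCost (c • η) ≤ transportCost α := by
    have := o2 (c⁻¹ • α) ⟨by simp [c, ENNReal.inv_mul_cancel hu hut]⟩
      (Measure.map_smul ..) (Measure.map_smul ..)
    rw [cost_smul] at this ⊢
    calc c * transportCost η ≤ c * (c⁻¹ * transportCost α) := by gcongr
      _ = transportCost α := by rw [← mul_assoc, ENNReal.mul_inv_cancel hu hut, one_mul]
  have hF := h.replace e0 e1 hcost
  set α2 := (c • η).restrict (eval s ⁻¹' S) with hα2
  have hle2 : α2 ≤ c • η := Measure.restrict_le_self
  have hm0 : α2.map (eval 0) ≤ α.map (eval 0) := by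
    rw [← e0]; exact Measure.map_mono hle2 (measurable_eval' 0)
  have hm1 : α2.map (eval 1) ≤ α.map (eval 1) := by
    rw [← e1]; exact Measure.map_mono hle2 (measurable_eval' 1)
  obtain ⟨β', hβ', hβe⟩ := equalize (measurable_eval' 0) (hm0.trans he.le)
  refine ⟨α2, β', ?_, hF.mono (add_le_add hle2 hβ'), hβe.symm, hm0, hm1, hβ', ?_, ?_⟩
  · intro hh
    have := congrArg (fun μ => μ univ) hh
    simp only [hα2, Measure.restrict_apply_univ, Measure.coe_zero, Pi.zero_apply,
      Measure.smul_apply, smul_eq_mul, mul_eq_zero] at this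
    rcases this with h | h
    · exact hu h
    · rw [Measure.map_apply (measurable_eval' s) hS] at hS0
      exact hS0 h
  · rw [hα2, map_restrict_eval _ _ hS, Measure.map_smul, Measure.restrict_smul]
    exact Measure.smul_absolutelyContinuous.trans hSac
  · refine Bd.mono (Bd.of_ends ?_ ?_) hle2
    · rw [e0]; exact hb.null 0
    · rw [e1]; exact hb.null 1
end P5

section P6
variable [Nonempty X] [SecondCountableTopology X] [BorelSpace X] {K N : ℝ} {m : Measure X}

theorem jensen_bound [SigmaFinite m] {p : ℝ} (hp : 1 < p) (ξ : Measure X) [IsProbabilityMeasure ξ]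
    {S : Set X} (hS : MeasurableSet S) (h0 : ξ Sᶜ = 0) :
    ∫⁻ x, (ξ.rnDeriv m x) ^ (1 - 1 / p) ∂m ≤ (m S) ^ (1 / p) := by
  have hp0 : 0 < p := by linarith
  have hpos : 0 < 1 - 1 / p := by
    have : 1 / p < 1 := by rw [div_lt_one hp0]; exact hp
    linarith
  have hz : ∀ᵐ x ∂m, x ∈ Sᶜ → ξ.rnDeriv m x = 0 := by
    have h1 : ∫⁻ x in Sᶜ, ξ.rnDeriv m x ∂m = 0 :=
      le_antisymm ((Measure.setLIntegral_rnDeriv_le _).trans h0.le) bot_le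
    rw [lintegral_eq_zero_iff (Measure.measurable_rnDeriv _ _)] at h1
    exact (ae_restrict_iff' hS.compl).1 h1
  have heq : ∫⁻ x, (ξ.rnDeriv m x) ^ (1 - 1 / p) ∂m =
      ∫⁻ x, ((fun x => (ξ.rnDeriv m x) ^ (1 - 1 / p)) * (S.indicator 1 : X → ℝ≥0∞)) x ∂m := by
    refine lintegral_congr_ae ?_
    filter_upwards [hz] with x hx
    by_cases hxs : x ∈ S
    · simp [hxs]
    · simp [hxs, hx hxs, inv_lt_one_of_one_lt₀ hp]
  rw [heq]
  have hconj : ((1 - 1 / p)⁻¹).HolderConjugate p := by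
    rw [Real.holderConjugate_iff]
    refine ⟨?_, ?_⟩
    · rw [one_lt_inv₀ hpos]
      have : 0 < 1 / p := by positivity
      linarith
    · rw [inv_inv]; simp
  refine (ENNReal.lintegral_mul_le_Lp_mul_Lq m hconj
    ((Measure.measurable_rnDeriv _ _).pow_const _).aemeasurable
    (measurable_one.indicator hS).aemeasurable).trans ?_
  have e1 : ∫⁻ x, ((ξ.rnDeriv m x) ^ (1 - 1 / p)) ^ (1 - 1 / p)⁻¹ ∂m ≤ 1 := by
    have : ∀ x, ((ξ.rnDeriv m x) ^ (1 - 1 / p)) ^ (1 - 1 / p)⁻¹ = ξ.rnDeriv m x := by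
      intro x
      rw [← ENNReal.rpow_mul, mul_inv_cancel₀ hpos.ne', ENNReal.rpow_one]
    simp only [this]
    exact (Measure.lintegral_rnDeriv_le).trans (by simp)
  have e2 : ∫⁻ x, (S.indicator (1 : X → ℝ≥0∞) x) ^ p ∂m = m S := by
    have : ∀ x, (S.indicator (1 : X → ℝ≥0∞) x) ^ p = S.indicator 1 x := by
      intro x
      by_cases hxs : x ∈ S
      · simp [hxs]
      · simp [hxs, hp0]
    simp only [this]
    rw [lintegral_indicator_one hS]
  rw [e2]
  calc _ ≤ (1 : ℝ≥0∞) ^ (1 / (1 - 1 / p)⁻¹) * m S ^ (1 / p) := by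
        gcongr
    _ = _ := by simp

theorem Hyp.vol0 (H : Hyp K N m) {ω : Measure (Geo X)} (h : FOpt ω) {x₀ : X} {R : ℝ}
    (hb : Bd x₀ R ω) (a1 : ω.map (eval 1) ≪ m) {r : unitInterval} {c : ℝ≥0∞}
    (hc : ∀ θ, 0 ≤ θ → θ ≤ 2 * R → c ≤ sigmaCoeff K (N + 1) (1 - r) θ)
    {D S : Set X} (hD : MeasurableSet D) (hS : MeasurableSet S) {a : ℝ≥0∞} (ha0 : a ≠ 0)
    (ha : a ≠ ⊤) (hm0 : m D ≠ 0) (hm1 : m D ≠ ⊤) (he : ω.map (eval 0) = a • m.restrict D)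
    (hSr : (ω.map (eval r)) Sᶜ = 0) :
    c ^ (N + 1) * m D ≤ m S := by
  have := H.sf
  have hN := H.hN
  have hN0 : 0 < N + 1 := by linarith
  have := h.1
  have hu : ω univ = a * m D := by
    have := congrArg (fun μ => μ univ) he
    simpa [Measure.map_apply (measurable_eval' _)] using this
  have hw : ω ≠ 0 := by
    intro hh
    rw [hh] at hu
    simp only [Measure.coe_zero, Pi.zero_apply] at hu
    exact (mul_ne_zero ha0 hm0) hu.symm
  have a0 : ω.map (eval 0) ≪ m := by
    rw [he]; exact Measure.smul_absolutelyContinuous.trans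
      (Measure.absolutelyContinuous_of_le Measure.restrict_le_self)
  obtain ⟨hp, hcd⟩ := H.cdi h hw hb a0 a1
  set η := (ω univ)⁻¹ • ω with hη
  have e0 : η.map (eval 0) = m.withDensity (D.indicator fun _ => (m D)⁻¹) := by
    rw [withDensity_indicator hD, withDensity_const, hη, Measure.map_smul, he, smul_smul, hu]
    congr 1
    rw [ENNReal.mul_inv (Or.inl ha0) (Or.inl ha), mul_comm, ← mul_assoc,
      ENNReal.mul_inv_cancel ha0 ha, one_mul]
  have hηac : η ≪ ω := Measure.smul_absolutelyContinuous
  have hd : ∀ᵐ γ ∂η, (η.map (eval 0)).rnDeriv m (eval 0 γ) = (m D)⁻¹ := by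
    have h1 : ∀ᵐ x ∂m, (η.map (eval 0)).rnDeriv m x = D.indicator (fun _ => (m D)⁻¹) x := by
      rw [e0]
      exact Measure.rnDeriv_withDensity m (measurable_const.indicator hD)
    have hac : η.map (eval 0) ≪ m := by rw [e0]; exact withDensity_absolutelyContinuous _ _
    have h2 : ∀ᵐ x ∂(η.map (eval 0)), x ∈ D := by
      rw [e0, withDensity_indicator hD, withDensity_const]
      exact Measure.smul_absolutelyContinuous.ae_le (ae_restrict_mem hD)
    have h3 := ae_of_ae_map (measurable_eval' 0).aemeasurable (Filter.Eventually.and (hac.ae_le h1) h2)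
    filter_upwards [h3] with γ hγ
    rw [hγ.1, indicator_of_mem hγ.2]
  have h1 := hcd r (N + 1) (by linarith)
  have hpr : IsProbabilityMeasure (η.map (eval r)) :=
    Measure.isProbabilityMeasure_map (measurable_eval' r).aemeasurable
  have h2 : ∫⁻ x, ((η.map (eval r)).rnDeriv m x) ^ (1 - 1 / (N + 1)) ∂m ≤ (m S) ^ (1 / (N + 1)) := by
    refine jensen_bound (by linarith) _ hS ?_
    rw [hη, Measure.map_smul, Measure.smul_apply, hSr]; simp
  have h3 : c * (m D) ^ (1 / (N + 1)) ≤ m S ^ (1 / (N + 1)) := by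
    refine le_trans ?_ (h1.trans h2)
    calc c * (m D) ^ (1 / (N + 1)) = ∫⁻ _, c * (m D) ^ (1 / (N + 1)) ∂η := by simp
      _ ≤ _ := by
        refine lintegral_mono_ae ?_
        filter_upwards [hd, (hb.ac hηac).len] with γ g1 g2
        refine le_trans ?_ le_self_add
        rw [g1, ENNReal.inv_rpow, ENNReal.rpow_neg, inv_inv]
        gcongr
        exact hc _ dist_nonneg g2
  have h4 := ENNReal.rpow_le_rpow h3 hN0.le
  rw [ENNReal.mul_rpow_of_nonneg _ _ hN0.le, ← ENNReal.rpow_mul, ← ENNReal.rpow_mul,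
    one_div_mul_cancel hN0.ne', ENNReal.rpow_one, ENNReal.rpow_one] at h4
  exact h4

theorem Hyp.vol1 (H : Hyp K N m) {ω : Measure (Geo X)} (h : FOpt ω) {x₀ : X} {R : ℝ}
    (hb : Bd x₀ R ω) (a0 : ω.map (eval 0) ≪ m) (a1 : ω.map (eval 1) ≪ m)
    {r : unitInterval} {c : ℝ≥0∞}
    (hc : ∀ θ, 0 ≤ θ → θ ≤ 2 * R → c ≤ sigmaCoeff K (N + 1) (1 - r) θ)
    {S0 S : Set X} (hS0 : MeasurableSet S0) (hS : MeasurableSet S)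
    (he : m.restrict S0 ≪ ω.map (eval 0)) (hSr : (ω.map (eval r)) Sᶜ = 0) :
    c ^ (N + 1) * m S0 ≤ m S := by
  have := H.sf
  have := h.1
  set μ := ω.map (eval 0) with hμ
  set ρ := μ.rnDeriv m with hρ
  have hρm : Measurable ρ := Measure.measurable_rnDeriv _ _
  have hwd : m.withDensity ρ = μ := Measure.withDensity_rnDeriv_eq _ _ a0
  let a : ℕ → ℝ≥0∞ := fun k => ((k : ℝ≥0∞) + 1)⁻¹
  have ha0 : ∀ k, a k ≠ 0 := fun k => ENNReal.inv_ne_zero.2 (by finiteness)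
  have ha1 : ∀ k, a k ≠ ⊤ := fun k => ENNReal.inv_ne_top.2 (by simp)
  let D : ℕ → Set X := fun k => S0 ∩ {x | a k ≤ ρ x}
  have hD : ∀ k, MeasurableSet (D k) := fun k =>
    hS0.inter (measurableSet_le measurable_const hρm)
  have hkey : ∀ k, c ^ (N + 1) * m (D k) ≤ m S := by
    intro k
    by_cases hz : m (D k) = 0
    · rw [hz]; simp
    have hle : a k • m.restrict (D k) ≤ μ := by
      rw [← hwd]
      refine Measure.le_iff.2 fun A hA => ?_
      rw [Measure.smul_apply, Measure.restrict_apply hA, smul_eq_mul, withDensity_apply _ hA]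
      calc a k * m (A ∩ D k) = ∫⁻ _ in A ∩ D k, a k ∂m := by simp
        _ ≤ ∫⁻ x in A ∩ D k, ρ x ∂m :=
          setLIntegral_mono' (hA.inter (hD k)) fun x hx => hx.2.2
        _ ≤ _ := lintegral_mono_set inter_subset_left
    obtain ⟨ω', hω', he'⟩ := equalize (measurable_eval' 0) hle
    have hfin : m (D k) ≠ ⊤ := by
      intro ht
      have := Measure.le_iff'.1 hle (D k)
      rw [Measure.smul_apply, Measure.restrict_apply (hD k), inter_self, ht, smul_eq_mul,
        ENNReal.mul_top (ha0 k)] at this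
      exact measure_ne_top μ (D k) (top_le_iff.1 this)
    have hmono : ∀ t, ω'.map (eval t) ≪ ω.map (eval t) := fun t =>
      Measure.absolutelyContinuous_of_le (Measure.map_mono hω' (measurable_eval' t))
    exact H.vol0 (h.mono hω') (hb.mono hω') ((hmono 1).trans a1) hc (hD k) hS (ha0 k) (ha1 k) hz
      hfin he' (hmono r hSr)
  have hDm : Monotone D := by
    intro i j hij x hx
    have h2 : a i ≤ ρ x := hx.2
    refine ⟨hx.1, ?_⟩
    change a j ≤ ρ x
    refine le_trans ?_ h2
    simp only [a]
    gcongr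
  have hzm : MeasurableSet {x | ρ x = 0} := hρm (measurableSet_singleton 0)
  have hU : m S0 ≤ m (⋃ k, D k) := by
    have h1 : μ {x | ρ x = 0} = 0 := by
      rw [← hwd, withDensity_apply _ hzm]
      rw [setLIntegral_congr_fun (g := fun _ => 0) hzm
        (fun x hx => hx)]
      simp
    have h2 := he h1
    rw [Measure.restrict_apply hzm] at h2
    calc m S0 ≤ m (({x | ρ x = 0} ∩ S0) ∪ ⋃ k, D k) := by
          refine measure_mono fun x hx => ?_
          by_cases hx0 : ρ x = 0
          · exact Or.inl ⟨hx0, hx⟩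
          · refine Or.inr (mem_iUnion.2 ?_)
            obtain ⟨k, hk⟩ := ENNReal.exists_inv_nat_lt hx0
            refine ⟨k, hx, ?_⟩
            change a k ≤ ρ x
            refine le_trans ?_ hk.le
            simp only [a]
            rw [ENNReal.inv_le_inv]
            exact le_self_add
      _ ≤ _ := (measure_union_le _ _).trans (by rw [h2, zero_add])
  rw [hDm.measure_iUnion] at hU
  calc _ ≤ c ^ (N + 1) * ⨆ k, m (D k) := by gcongr
    _ = ⨆ k, c ^ (N + 1) * m (D k) := ENNReal.mul_iSup ..
    _ ≤ _ := iSup_le hkey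

theorem Hyp.vol (H : Hyp K N m) (R : ℝ) : ∃ κ : ℝ, 0 < κ ∧ ∀ (x₀ : X) (ω : Measure (Geo X)),
    FOpt ω → Bd x₀ R ω → ω.map (eval 0) ≪ m → ω.map (eval 1) ≪ m →
    ∀ r : unitInterval, (r : ℝ) ≤ κ → ∀ S0 S : Set X, MeasurableSet S0 → MeasurableSet S →
      m.restrict S0 ≪ ω.map (eval 0) → (ω.map (eval r)) Sᶜ = 0 → 4 * m S0 ≤ 5 * m S := by
  have hN := H.hN
  have hN0 : 0 < N + 1 := by linarith
  set C := Real.cosh (2 * R * Real.sqrt (|K| / (N + 1))) with hC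
  have hC0 : 0 < C := Real.cosh_pos _
  set b : ℝ := (4 / 5 : ℝ) ^ (1 / (N + 1)) with hb
  have hb1 : b < 1 := Real.rpow_lt_one (by norm_num) (by norm_num) (by positivity)
  have hb0 : 0 ≤ b := by positivity
  have hbN : b ^ (N + 1) = 4 / 5 := by
    rw [hb, ← Real.rpow_mul (by norm_num), one_div_mul_cancel hN0.ne', Real.rpow_one]
  refine ⟨(1 - b) / C, div_pos (by linarith) hC0, ?_⟩
  intro x₀ ω h hbd a0 a1 r hr S0 S hS0 hS he hSr
  have hr' : r * C ≤ 1 - b := by rwa [le_div_iff₀ hC0] at hr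
  have := H.vol1 h hbd a0 a1 (r := r) (c := ENNReal.ofReal b) (fun θ h1 h2 =>
    (ENNReal.ofReal_le_ofReal (by linarith)).trans (sigma_ge hN0 r.2.1 r.2.2 h1 h2)) hS0 hS he hSr
  rw [ENNReal.ofReal_rpow_of_nonneg hb0 hN0.le, hbN] at this
  calc 4 * m S0 = 5 * (ENNReal.ofReal (4 / 5) * m S0) := by
        rw [← mul_assoc]; congr 1
        rw [show (5 : ℝ≥0∞) = ENNReal.ofReal 5 by simp, ← ENNReal.ofReal_mul (by norm_num)]
        norm_num
    _ ≤ _ := by gcongr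
end P6

def VolP (m : Measure X) (R κ : ℝ) : Prop := ∀ (x₀ : X) (ω : Measure (Geo X)),
    FOpt ω → Bd x₀ R ω → ω.map (eval 0) ≪ m → ω.map (eval 1) ≪ m →
    ∀ r : unitInterval, (r : ℝ) ≤ κ → ∀ S0 S : Set X, MeasurableSet S0 → MeasurableSet S →
      m.restrict S0 ≪ ω.map (eval 0) → (ω.map (eval r)) Sᶜ = 0 → 4 * m S0 ≤ 5 * m S

section P7
variable [Nonempty X] [SecondCountableTopology X] [BorelSpace X] {K N : ℝ} {m : Measure X}

theorem overlap {Y : Type*} [MeasurableSpace Y] {α β : Measure Y} [IsFiniteMeasure α]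
    [IsFiniteMeasure β] {f : Y → X} (hf : Measurable f) (h : ¬ (α.map f) ⟂ₘ (β.map f)) :
    ∃ α' ≤ α, ∃ β' ≤ β, α' ≠ 0 ∧ α'.map f = β'.map f := by
  set ξ := α.map f
  set ζ := β.map f
  set g : X → ℝ≥0∞ := fun x => min (ξ.rnDeriv ζ x) 1 with hg
  have hgm : Measurable g := (Measure.measurable_rnDeriv _ _).min measurable_const
  have h1 : ζ.withDensity g ≤ ξ :=
    (withDensity_mono (ae_of_all _ fun x => min_le_left _ _)).trans (Measure.withDensity_rnDeriv_le ξ ζ)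
  have h2 : ζ.withDensity g ≤ ζ := by
    calc ζ.withDensity g ≤ ζ.withDensity 1 :=
          withDensity_mono (ae_of_all _ fun x => min_le_right _ _)
      _ = ζ := withDensity_one
  obtain ⟨α', hα', ea⟩ := equalize hf h1
  obtain ⟨β', hβ', eb⟩ := equalize hf h2
  refine ⟨α', hα', β', hβ', ?_, ea.trans eb.symm⟩
  rintro rfl
  apply h
  rw [Measure.map_zero] at ea
  have h3 := (withDensity_eq_zero_iff hgm.aemeasurable).1 ea.symm
  rw [← Measure.rnDeriv_eq_zero]
  filter_upwards [h3] with x hx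
  simp only [hg, Pi.zero_apply] at hx ⊢
  rcases min_eq_bot.1 hx with h | h
  · exact h
  · simp at h

theorem posset [SigmaFinite m] {τ : Measure X} [IsFiniteMeasure τ] (h : τ ≪ m) {B : Set X}
    (hB : MeasurableSet B) (hτ : τ Bᶜ = 0) :
    ∃ D ⊆ B, MeasurableSet D ∧ τ Dᶜ = 0 ∧ m.restrict D ≪ τ := by
  set ρ := τ.rnDeriv m
  have hρm : Measurable ρ := Measure.measurable_rnDeriv _ _
  have hwd : m.withDensity ρ = τ := Measure.withDensity_rnDeriv_eq _ _ h
  have hzm : MeasurableSet {x | ρ x = 0} := hρm (measurableSet_singleton 0)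
  refine ⟨B ∩ {x | ρ x = 0}ᶜ, inter_subset_left, hB.inter hzm.compl, ?_, ?_⟩
  · rw [compl_inter, compl_compl]
    refine measure_union_null hτ ?_
    rw [← hwd, withDensity_apply _ hzm,
      setLIntegral_congr_fun (g := fun _ => 0) hzm (fun x hx => hx)]
    simp
  · refine Measure.AbsolutelyContinuous.mk fun A hA hτA => ?_
    rw [← hwd, withDensity_apply _ hA, lintegral_eq_zero_iff hρm] at hτA
    have h1 : (m.restrict A) {x | ρ x = 0}ᶜ = 0 := hτA
    rw [Measure.restrict_apply hzm.compl] at h1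
    rw [Measure.restrict_apply hA]
    refine measure_mono_null ?_ h1
    rintro x ⟨hx1, -, hx2⟩
    exact ⟨hx2, hx1⟩

theorem map_ne_zero' {α : Measure (Geo X)} (h : α ≠ 0) (r : unitInterval) : α.map (eval r) ≠ 0 := by
  intro hh
  have := congrArg (fun μ => μ univ) hh
  rw [Measure.map_apply (measurable_eval' r) MeasurableSet.univ] at this
  simp at this
  exact h this

theorem step_ns (H : Hyp K N m) {α β : Measure (Geo X)} (hα : α ≠ 0) (hF : FOpt (α + β)) {x₀ : X}
    {R κ : ℝ} (hV : VolP m R κ) (hb : Bd x₀ R (α + β)) (a0 : (α + β).map (eval 0) ≪ m)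
    (a1 : (α + β).map (eval 1) ≪ m) {r r' : unitInterval} (hr : (r : ℝ) < r') (hr1 : (r' : ℝ) < 1)
    (k1 : (r' : ℝ) - r ≤ κ * (1 - r)) (k2 : (r' : ℝ) - r ≤ κ * r')
    (he : α.map (eval r) = β.map (eval r)) : ¬ (α.map (eval r')) ⟂ₘ (β.map (eval r')) := by
  rintro ⟨S, hS, hSa, hSb⟩
  have := H.sf
  have hr0 : (0 : ℝ) ≤ r := r.2.1
  have hla : α ≤ α + β := Measure.le_add_right le_rfl
  have hlb : β ≤ α + β := Measure.le_add_left le_rfl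
  have hFa := hF.mono hla
  have hFb := hF.mono hlb
  have := hFa.1
  have := hFb.1
  have hac := H.ac hF hb a0 a1
  have haca : ∀ t, α.map (eval t) ≪ m := fun t => (Measure.absolutelyContinuous_of_le
    (Measure.map_mono hla (measurable_eval' t))).trans (hac t)
  have hacb : ∀ t, β.map (eval t) ≪ m := fun t => (Measure.absolutelyContinuous_of_le
    (Measure.map_mono hlb (measurable_eval' t))).trans (hac t)
  have hBfin := H.hfin x₀ R
  obtain ⟨D, hDB, hDm, hD0, hDac⟩ := posset (haca r) measurableSet_closedBall ((hb.mono hla).null r)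
  obtain ⟨F, hFB, hFm, hF0, hFac⟩ := posset (hac r') measurableSet_closedBall (hb.null r')
  rw [Measure.map_add _ _ (measurable_eval' r')] at hF0
  simp only [Measure.add_apply, add_eq_zero] at hF0
  have hDpos : m D ≠ 0 := by
    intro h0
    apply map_ne_zero' hα r
    rw [← Measure.measure_univ_eq_zero, ← union_compl_self D]
    exact measure_union_null (haca r h0) hD0
  have f1 : 4 * m D ≤ 5 * m (F \ S) := by
    refine hV x₀ (α.map (reparam r 1)) (hFa.restr1 H.hCD (hr.trans hr1)) ((hb.mono hla).map _ _)
      (by rw [map_eval_reparam, affI_zero]; exact haca r)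
      (by rw [map_eval_reparam, affI_one]; exact haca 1)
      ⟨((r' : ℝ) - r) / (1 - r), div_nonneg (by linarith) (by linarith),
        (div_le_one (by linarith)).2 (by linarith)⟩ ?_ D (F \ S) hDm (hFm.diff hS) ?_ ?_
    · exact (div_le_iff₀ (by linarith)).2 k1
    · rw [map_eval_reparam, affI_zero]; exact hDac
    · rw [map_eval_reparam]
      rw [show affI r 1 _ = r' by
        ext; simp only [affI, Icc.coe_one]
        have : (1 : ℝ) - r ≠ 0 := by linarith
        field_simp
        ring]
      rw [sdiff_eq, compl_inter, compl_compl]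
      exact measure_union_null hF0.1 hSa
  have f2 : 4 * m D ≤ 5 * m (F ∩ S) := by
    refine hV x₀ (β.map (reparam r 1)) (hFb.restr1 H.hCD (hr.trans hr1)) ((hb.mono hlb).map _ _)
      (by rw [map_eval_reparam, affI_zero]; exact hacb r)
      (by rw [map_eval_reparam, affI_one]; exact hacb 1)
      ⟨((r' : ℝ) - r) / (1 - r), div_nonneg (by linarith) (by linarith),
        (div_le_one (by linarith)).2 (by linarith)⟩ ?_ D (F ∩ S) hDm (hFm.inter hS) ?_ ?_
    · exact (div_le_iff₀ (by linarith)).2 k1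
    · rw [map_eval_reparam, affI_zero, ← he]; exact hDac
    · rw [map_eval_reparam]
      rw [show affI r 1 _ = r' by
        ext; simp only [affI, Icc.coe_one]
        have : (1 : ℝ) - r ≠ 0 := by linarith
        field_simp
        ring]
      rw [compl_inter]
      exact measure_union_null hF0.2 hSb
  have f3 : 4 * m F ≤ 5 * m D := by
    have hr'0 : (0 : ℝ) < r' := lt_of_le_of_lt hr0 hr
    refine hV x₀ ((α + β).map (reparam r' 0)) (hF.back H.hCD hr'0) (hb.map _ _)
      (by rw [map_eval_reparam, affI_zero]; exact hac r')
      (by rw [map_eval_reparam, affI_one]; exact hac 0)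
      ⟨((r' : ℝ) - r) / r', div_nonneg (by linarith) (by linarith),
        (div_le_one (by linarith)).2 (by linarith)⟩ ?_ F D hFm hDm ?_ ?_
    · exact (div_le_iff₀ (by linarith)).2 k2
    · rw [map_eval_reparam, affI_zero]; exact hFac
    · rw [map_eval_reparam]
      rw [show affI r' 0 _ = r by
        ext; simp only [affI, Icc.coe_zero]
        field_simp
        ring]
      rw [Measure.map_add _ _ (measurable_eval' r), ← he]
      simp [hD0]
  have hsum : m (F ∩ S) + m (F \ S) = m F := measure_inter_add_sdiff F hS
  have fin : ∀ Z ⊆ closedBall x₀ R, m Z ≠ ⊤ := fun Z hZ => ne_top_of_le_ne_top hBfin (measure_mono hZ)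
  have t1 := fin D hDB
  have t2 := fin (F ∩ S) (inter_subset_left.trans hFB)
  have t3 := fin (F \ S) (sdiff_subset.trans hFB)
  rw [← hsum] at f3
  generalize m D = x at *
  generalize m (F ∩ S) = y at *
  generalize m (F \ S) = z at *
  lift x to ℝ≥0 using t1
  lift y to ℝ≥0 using t2
  lift z to ℝ≥0 using t3
  norm_cast at f1 f2 f3 hDpos
  have : 0 < x := pos_iff_ne_zero.2 hDpos
  rw [← NNReal.coe_le_coe] at f1 f2 f3
  rw [← NNReal.coe_pos] at this
  push_cast at *
  linarith

theorem base_ns (H : Hyp K N m) {α β : Measure (Geo X)} (hα : α ≠ 0) (hF : FOpt (α + β)) {x₀ : X}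
    {R κ : ℝ} (hκ : 0 < κ) (hV : VolP m R κ) (hb : Bd x₀ R (α + β))
    (a0 : (α + β).map (eval 0) ≪ m)
    (a1 : (α + β).map (eval 1) ≪ m) 
    (he : α.map (eval 0) = β.map (eval 0)) : ∃ s0 : ℝ, 0 < s0 ∧ ∀ s : unitInterval, (s : ℝ) ≤ s0 →
      ¬ (α.map (eval s)) ⟂ₘ (β.map (eval s)) := by
  have := H.sf
  have hla : α ≤ α + β := Measure.le_add_right le_rfl
  have hlb : β ≤ α + β := Measure.le_add_left le_rfl
  have hFa := hF.mono hla
  have hFb := hF.mono hlb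
  have := hFa.1
  have := hFb.1
  have hac := H.ac hF hb a0 a1
  have haca : ∀ t, α.map (eval t) ≪ m := fun t => (Measure.absolutelyContinuous_of_le
    (Measure.map_mono hla (measurable_eval' t))).trans (hac t)
  have hacb : ∀ t, β.map (eval t) ≪ m := fun t => (Measure.absolutelyContinuous_of_le
    (Measure.map_mono hlb (measurable_eval' t))).trans (hac t)
  have hBfin := H.hfin x₀ R
  obtain ⟨D0, hDB, hDm, hD0, hDac⟩ := posset (haca 0) measurableSet_closedBall ((hb.mono hla).null 0)
  have hDpos : m D0 ≠ 0 := by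
    intro h0
    apply map_ne_zero' hα 0
    rw [← Measure.measure_univ_eq_zero, ← union_compl_self D0]
    exact measure_union_null (haca 0 h0) hD0
  have hfinB : IsFiniteMeasure (m.restrict (closedBall x₀ R)) :=
    ⟨by rw [Measure.restrict_apply_univ]; exact lt_top_iff_ne_top.2 hBfin⟩
  have hrB : ∀ Z ⊆ closedBall x₀ R, m.restrict (closedBall x₀ R) Z = m Z := fun Z hZ => by
    rw [Measure.restrict_eq_self _ hZ]
  obtain ⟨D, hDD, hDc, hDp⟩ := hDm.exists_lt_isClosed_of_ne_top
    (μ := m.restrict (closedBall x₀ R)) (measure_ne_top _ _) (r := 0)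
    (by rw [hrB _ hDB]; exact pos_iff_ne_zero.2 hDpos)
  rw [hrB _ (hDD.trans hDB)] at hDp
  have hDfin : m D ≠ ⊤ := ne_top_of_le_ne_top hBfin (measure_mono (hDD.trans hDB))
  have hbdd : ∀ Z : Set X, Bornology.IsBounded Z → m Z ≠ ⊤ := fun Z hZ => by
    obtain ⟨R', hR'⟩ := hZ.subset_closedBall x₀
    exact ne_top_of_le_ne_top (H.hfin x₀ R') (measure_mono hR')
  have hDb : Bornology.IsBounded D := isBounded_closedBall.subset (hDD.trans hDB)
  have htend := tendsto_measure_cthickening_of_isClosed (μ := m) (s := D)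
    ⟨1, one_pos, hbdd _ hDb.cthickening⟩ hDc
  have hlt : m D < (3 / 2 : ℝ≥0) * m D := by
    generalize m D = x at *
    lift x to ℝ≥0 using hDfin
    norm_cast at hDp ⊢
    rw [← NNReal.coe_lt_coe] at hDp ⊢
    push_cast at *
    linarith
  obtain ⟨ε, hε, hεb⟩ := Metric.eventually_nhds_iff.1 (htend.eventually_lt_const hlt)
  have hRp : 0 < |R| + 1 := by positivity
  refine ⟨min κ (ε / (4 * (|R| + 1))), lt_min hκ (by positivity), ?_⟩
  rintro s hs ⟨S, hS, hSa, hSb⟩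
  have hsκ := hs.trans (min_le_left _ _)
  have hsε := hs.trans (min_le_right _ _)
  rw [le_div_iff₀ (by positivity)] at hsε
  have hs0 : (0 : ℝ) ≤ s := s.2.1
  set C := cthickening (s * (2 * |R|)) D
  have hCm : MeasurableSet C := isClosed_cthickening.measurableSet
  have hClt : m C < (3 / 2 : ℝ≥0) * m D := by
    apply hεb
    rw [Real.dist_eq, sub_zero, abs_of_nonneg (by positivity)]
    nlinarith [abs_nonneg R]
  have hCfin : m C ≠ ⊤ := hbdd _ hDb.cthickening
  have hcarry : ∀ ζ : Measure (Geo X), ζ ≤ α + β →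
      (((ζ.restrict (eval 0 ⁻¹' D)).map (eval s)) Cᶜ = 0) := by
    intro ζ hζ
    rw [Measure.map_apply (measurable_eval' s) hCm.compl]
    refine measure_eq_zero_iff_ae_notMem.2 ?_
    have hbz := (hb.mono hζ).mono (Measure.restrict_le_self (s := eval 0 ⁻¹' D))
    filter_upwards [hbz.len, ae_restrict_mem (measurable_eval' 0 hDc.measurableSet)] with γ h1 h2
    simp only [mem_preimage, mem_compl_iff, not_not]
    refine mem_cthickening_of_dist_le _ _ _ _ h2 ?_
    rw [geo_dist, Icc.coe_zero, sub_zero, abs_of_nonneg hs0]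
    have := le_abs_self R
    gcongr
    linarith
  have hstart : m.restrict D ≪ (α.map (eval 0)).restrict D := by
    have := hDac.restrict D
    rwa [Measure.restrict_restrict hDc.measurableSet, inter_eq_self_of_subset_left hDD] at this
  have key : ∀ ζ : Measure (Geo X), ζ ≤ α + β → ζ.map (eval 0) = α.map (eval 0) →
      ∀ T, MeasurableSet T → (ζ.map (eval s)) Tᶜ = 0 → 4 * m D ≤ 5 * m (C ∩ T) := by
    intro ζ hζ hζ0 T hT hζT
    have hle : ζ.restrict (eval 0 ⁻¹' D) ≤ ζ := Measure.restrict_le_self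
    have hle' := hle.trans hζ
    have hacz : ∀ t, (ζ.restrict (eval 0 ⁻¹' D)).map (eval t) ≪ m := fun t =>
      (Measure.absolutelyContinuous_of_le
        (Measure.map_mono hle' (measurable_eval' t))).trans (hac t)
    refine hV x₀ _ (hF.mono hle') (hb.mono hle') (hacz 0) (hacz 1) s hsκ D (C ∩ T)
      hDc.measurableSet (hCm.inter hT) ?_ ?_
    · rw [map_restrict_eval _ _ hDc.measurableSet, hζ0]; exact hstart
    · rw [compl_inter]
      exact measure_union_null (hcarry ζ hζ) (Measure.absolutelyContinuous_of_le
        (Measure.map_mono hle (measurable_eval' s)) hζT)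
  have f1 := key α hla rfl Sᶜ hS.compl (by rwa [compl_compl])
  have f2 := key β hlb he.symm S hS hSb
  have hsum : m (C ∩ S) + m (C \ S) = m C := measure_inter_add_sdiff C hS
  rw [← sdiff_eq] at f1
  have t2 : m (C ∩ S) ≠ ⊤ := ne_top_of_le_ne_top hCfin (measure_mono inter_subset_left)
  have t3 : m (C \ S) ≠ ⊤ := ne_top_of_le_ne_top hCfin (measure_mono sdiff_subset)
  rw [← hsum] at hClt
  clear htend hlt hεb hCfin hsum
  generalize m D = x at *
  generalize m (C ∩ S) = y at *
  generalize m (C \ S) = z at *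
  lift x to ℝ≥0 using hDfin
  lift y to ℝ≥0 using t2
  lift z to ℝ≥0 using t3
  norm_cast at f1 f2 hClt
  rw [← NNReal.coe_le_coe] at f1 f2 
  rw [← NNReal.coe_lt_coe] at hClt
  push_cast at *
  linarith
end P7

section P8
variable [Nonempty X] [SecondCountableTopology X] [BorelSpace X] {K N : ℝ} {m : Measure X}

theorem map_ac {α β : Measure (Geo X)} (h : α ≤ β) (t : unitInterval) :
    α.map (eval t) ≪ β.map (eval t) :=
  Measure.absolutelyContinuous_of_le (Measure.map_mono h (measurable_eval' t))

theorem Hyp.contra (H : Hyp K N m) {α β : Measure (Geo X)} (hα : α ≠ 0) (hF : FOpt (α + β)) {x₀ : X}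
    {R : ℝ} (hb : Bd x₀ R (α + β)) (a0 : (α + β).map (eval 0) ≪ m)
    (a1 : (α + β).map (eval 1) ≪ m) (he : α.map (eval 0) = β.map (eval 0))
    {u : unitInterval} (hu0 : 0 < (u : ℝ)) (hu1 : (u : ℝ) < 1) :
    ¬ (α.map (eval u)) ⟂ₘ (β.map (eval u)) := by
  intro hsing
  obtain ⟨κ, hκ, hV⟩ := H.vol R
  obtain ⟨s0, hs0, hbase⟩ := base_ns H hα hF hκ hV hb a0 a1 he
  set s : ℝ := min s0 u with hs
  have hsp : 0 < s := lt_min hs0 hu0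
  have hsu : s ≤ u := min_le_right _ _
  set h : ℝ := κ * min s (1 - u) with hh
  have hhp : 0 < h := mul_pos hκ (lt_min hsp (by linarith))
  have hh1 : h ≤ κ * (1 - u) := mul_le_mul_of_nonneg_left (min_le_right _ _) hκ.le
  have hh2 : h ≤ κ * s := mul_le_mul_of_nonneg_left (min_le_left _ _) hκ.le
  have hfin : ∀ ζ ≤ α + β, IsFiniteMeasure ζ := fun ζ hζ => (hF.mono hζ).1
  have hla : α ≤ α + β := Measure.le_add_right le_rfl
  have hlb : β ≤ α + β := Measure.le_add_left le_rfl
  let q : ℕ → unitInterval := fun n => ⟨min u (s + n * h), le_min hu0.le (by positivity),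
    (min_le_left _ _).trans hu1.le⟩
  have hq : ∀ n, (q n : ℝ) = min (u : ℝ) (s + n * h) := fun n => rfl
  let P : unitInterval → Prop := fun r => ∃ α' ≤ α, ∃ β' ≤ β, α' ≠ 0 ∧
    α'.map (eval r) = β'.map (eval r)
  have hP : ∀ n, P (q n) := by
    intro n
    induction n with
    | zero =>
      have := hfin _ hla
      have := hfin _ hlb
      refine overlap (measurable_eval' _) (hbase _ ?_)
      rw [hq]
      simp only [Nat.cast_zero, zero_mul, add_zero]
      exact (min_le_right _ _).trans (min_le_left _ _)
    | succ n ih =>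
      obtain ⟨α', hα', β', hβ', hne, hee⟩ := ih
      have hle : (q n : ℝ) ≤ q (n + 1) := by
        rw [hq, hq]
        push_cast
        exact min_le_min le_rfl (by linarith)
      rcases hle.eq_or_lt with heq | hlt
      · have : q (n + 1) = q n := by ext; exact heq.symm
        rw [this]
        exact ⟨α', hα', β', hβ', hne, hee⟩
      have hle' : α' + β' ≤ α + β := add_le_add hα' hβ'
      have := hfin α' (hα'.trans hla)
      have := hfin β' (hβ'.trans hlb)
      have hdiff : (q (n + 1) : ℝ) - q n ≤ h := by
        rw [hq, hq]
        push_cast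
        rcases min_cases (u : ℝ) (s + n * h) with ⟨e, _⟩ | ⟨e, _⟩
        · rw [e]
          have := min_le_left (u : ℝ) (s + (n + 1) * h)
          linarith
        · rw [e]
          have := min_le_right (u : ℝ) (s + (n + 1) * h)
          linarith
      have hqs : ∀ n, s ≤ q n := by
        intro n
        rw [hq]
        refine le_min hsu ?_
        have : 0 ≤ n * h := by positivity
        linarith
      have hqu : ∀ n, (q n : ℝ) ≤ u := fun n => min_le_left _ _
      obtain ⟨α'', h1, β'', h2, h3, h4⟩ := overlap (measurable_eval' (q (n + 1)))
        (step_ns H hne (hF.mono hle') hV (hb.mono hle') ((map_ac hle' 0).trans a0)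
        ((map_ac hle' 1).trans a1) hlt ((hqu _).trans_lt hu1)
        (hdiff.trans (hh1.trans (mul_le_mul_of_nonneg_left (by linarith [hqu n]) hκ.le)))
        (hdiff.trans (hh2.trans (mul_le_mul_of_nonneg_left (hqs _) hκ.le))) hee)
      exact ⟨α'', h1.trans hα', β'', h2.trans hβ', h3, h4⟩
  obtain ⟨n, hn⟩ := exists_nat_gt (1 / h)
  have hnu : q n = u := by
    ext
    rw [hq]
    apply min_eq_left
    rw [div_lt_iff₀ hhp] at hn
    linarith
  have hPu := hP n
  rw [hnu] at hPu
  obtain ⟨α', hα', β', hβ', hne, hee⟩ := hPu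
  have hs2 := hsing.mono_ac (map_ac hα' u) (map_ac hβ' u)
  rw [← hee, Measure.MutuallySingular.self_iff] at hs2
  exact map_ne_zero' hne u hs2

theorem Bd.weaken {x₀ : X} {R R' : ℝ} {α : Measure (Geo X)} (h : Bd x₀ R α) (hR : R ≤ R') :
    Bd x₀ R' α := by
  filter_upwards [h] with γ hγ r
  exact (hγ r).trans hR

theorem restrict_ne_zero' {α : Measure (Geo X)} {r : unitInterval} {A : Set X}
    (hA : MeasurableSet A) (h : (α.map (eval r)) A ≠ 0) : α.restrict (eval r ⁻¹' A) ≠ 0 := by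
  intro hh
  apply h
  have := congrArg (fun μ => μ univ) hh
  simp only [Measure.restrict_apply_univ, Measure.coe_zero, Pi.zero_apply] at this
  rwa [Measure.map_apply (measurable_eval' r) hA]

theorem ne_zero_of_start {α β : Measure (Geo X)} (he : α.map (eval 0) = β.map (eval 0))
    (h : α ≠ 0) : β ≠ 0 := by
  rintro rfl
  exact map_ne_zero' h 0 (by rw [he]; simp)

theorem Hyp.main3 (H : Hyp K N m) {α β : Measure (Geo X)} (hα : α ≠ 0) (hF : FOpt (α + β)) {x₀ : X}
    {R : ℝ} (hR : 0 ≤ R) (hb : Bd x₀ R (α + β)) (he : α.map (eval 0) = β.map (eval 0))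
    (a0 : α.map (eval 0) ≪ m) {A : Set X} (hA : IsClosed A) (hβA : (β.map (eval 1)) Aᶜ = 0)
    {δ : ℝ} (hδ : 0 < δ) (hαA : (α.map (eval 1)) {x | infDist x A < δ} = 0) : False := by
  set d : ℝ := min (1 / 2) (δ / (24 * (R + 1))) with hd
  have hd0 : 0 < d := lt_min (by norm_num) (by positivity)
  have hd1 : d ≤ 1 / 2 := min_le_left _ _
  have hd2 : d * (2 * (3 * R)) < δ / 2 := by
    have : d ≤ δ / (24 * (R + 1)) := min_le_right _ _
    rw [le_div_iff₀ (by positivity)] at this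
    nlinarith
  let u : unitInterval := ⟨1 - d, by linarith, by linarith⟩
  let s : unitInterval := ⟨1 - d / 2, by linarith, by linarith⟩
  have hu : (u : ℝ) = 1 - d := rfl
  have hs : (s : ℝ) = 1 - d / 2 := rfl
  have hs0 : 0 < (s : ℝ) := by rw [hs]; linarith
  have hs1 : (s : ℝ) < 1 := by rw [hs]; linarith
  have hla : α ≤ α + β := Measure.le_add_right le_rfl
  have hlb : β ≤ α + β := Measure.le_add_left le_rfl
  obtain ⟨α1, β1, p1, p2, p3, p4, p5, p6, p7, p8⟩ := H.J hα hF he a0 (hb.mono hla) hs1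
  have a1 : α1.map (eval 0) ≪ m := (Measure.absolutelyContinuous_of_le p4).trans a0
  obtain ⟨β2, α2, q1, q2, q3, q4, q5, q6, q7, q8⟩ := H.J (ne_zero_of_start p3 p1)
    (by rw [add_comm]; exact p2) p3.symm (by rw [← p3]; exact a1) ((hb.mono hlb).mono p6) hs1
  have b2 : β2.map (eval 0) ≪ m :=
    (Measure.absolutelyContinuous_of_le q4).trans (by rw [← p3]; exact a1)
  have hBd : Bd x₀ (3 * R) (α2 + β2) := (p8.mono q6).add q8
  have hFF : FOpt (α2 + β2) := by rw [add_comm]; exact q2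
  have hle2 : α2 ≤ α2 + β2 := Measure.le_add_right le_rfl
  have hle2' : β2 ≤ α2 + β2 := Measure.le_add_left le_rfl
  have hα2A : (α2.map (eval 1)) {x | infDist x A < δ} = 0 :=
    map_ac q6 1 (Measure.absolutelyContinuous_of_le p5 hαA)
  have hβ2A : (β2.map (eval 1)) Aᶜ = 0 :=
    Measure.absolutelyContinuous_of_le q5 (map_ac p6 1 hβA)
  have hma : ∀ ζ : Measure (Geo X), (ζ.map (reparam 0 s)).map (eval 0) = ζ.map (eval 0) := by
    intro ζ; rw [map_eval_reparam, affI_zero]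
  have hma1 : ∀ ζ : Measure (Geo X), (ζ.map (reparam 0 s)).map (eval 1) = ζ.map (eval s) := by
    intro ζ; rw [map_eval_reparam, affI_one]
  have hadd : α2.map (reparam 0 s) + β2.map (reparam 0 s) = (α2 + β2).map (reparam 0 s) :=
    (Measure.map_add _ _ (measurable_reparam 0 s)).symm
  have hmadd : ∀ t, (α2 + β2).map (eval t) = α2.map (eval t) + β2.map (eval t) := fun t =>
    Measure.map_add _ _ (measurable_eval' t)
  have hnz : α2.map (reparam 0 s) ≠ 0 := by
    intro hh
    apply map_ne_zero' (ne_zero_of_start q3 q1) 0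
    rw [← hma, hh]; simp
  have hdist : ∀ᵐ γ ∂(α2 + β2), dist (eval u γ) (eval 1 γ) < δ / 2 := by
    filter_upwards [hBd.len] with γ hγ
    rw [geo_dist, hu, Icc.coe_one, show (1 : ℝ) - d - 1 = -d by ring, abs_neg, abs_of_pos hd0]
    exact (mul_le_mul_of_nonneg_left hγ hd0.le).trans_lt hd2
  let v : unitInterval := ⟨(u : ℝ) / s, by rw [hu, hs]; exact div_nonneg (by linarith) (by linarith),
    (div_le_one hs0).2 (by rw [hu, hs]; linarith)⟩
  have hv : (v : ℝ) = u / s := rfl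
  have haff : affI 0 s v = u := by
    ext
    simp only [affI, hv, Icc.coe_zero]
    field_simp
    ring
  refine H.contra hnz (by rw [hadd]; exact hFF.restr0 H.hCD hs0)
    (by rw [hadd]; exact hBd.map _ _) ?_ ?_ (by rw [hma, hma, q3]) (u := v) ?_ ?_ ?_
  · rw [hadd, hma, hmadd]
    exact Measure.AbsolutelyContinuous.add_left (by rw [← q3]; exact b2) b2
  · rw [hadd, hma1, hmadd]
    exact Measure.AbsolutelyContinuous.add_left ((map_ac q6 s).trans p7) q7
  · rw [hv]; exact div_pos (by rw [hu]; linarith) hs0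
  · rw [hv, div_lt_one hs0, hu, hs]; linarith
  · rw [map_eval_reparam, map_eval_reparam, haff]
    have hT : MeasurableSet {x | infDist x A < δ / 2} :=
      measurableSet_lt measurable_infDist measurable_const
    refine ⟨{x | infDist x A < δ / 2}, hT, ?_, ?_⟩
    · rw [Measure.map_apply (measurable_eval' u) hT]
      refine measure_eq_zero_iff_ae_notMem.2 ?_
      have h1 := ae_of_ae_map (measurable_eval' 1).aemeasurable
        (measure_eq_zero_iff_ae_notMem.1 hα2A)
      filter_upwards [h1, Measure.absolutelyContinuous_of_le hle2 hdist] with γ g1 g2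
      simp only [mem_setOf_eq, mem_preimage, not_lt] at g1 ⊢
      have := infDist_le_infDist_add_dist (s := A) (x := eval 1 γ) (y := eval u γ)
      rw [dist_comm] at this
      linarith
    · rw [Measure.map_apply (measurable_eval' u) hT.compl]
      refine measure_eq_zero_iff_ae_notMem.2 ?_
      have h1 := ae_of_ae_map (measurable_eval' 1).aemeasurable
        (measure_eq_zero_iff_ae_notMem.1 hβ2A)
      filter_upwards [h1, Measure.absolutelyContinuous_of_le hle2' hdist] with γ g1 g2
      simp only [mem_setOf_eq, mem_preimage, mem_compl_iff, not_not, not_lt, not_le] at g1 ⊢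
      exact (infDist_le_dist_of_mem g1).trans_lt g2

theorem Hyp.main2 (H : Hyp K N m) {α β : Measure (Geo X)} (hα : α ≠ 0) (hF : FOpt (α + β)) {x₀ : X}
    {R : ℝ} (hR : 0 ≤ R) (hb : Bd x₀ R (α + β)) (he : α.map (eval 0) = β.map (eval 0))
    (a0 : α.map (eval 0) ≪ m) {A : Set X} (hA : MeasurableSet A) (hβA : (β.map (eval 1)) Aᶜ = 0)
    (hαA : (α.map (eval 1)) A = 0) : False := by
  have hla : α ≤ α + β := Measure.le_add_right le_rfl
  have hlb : β ≤ α + β := Measure.le_add_left le_rfl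
  have := (hF.mono hla).1
  have := (hF.mono hlb).1
  have hβ := ne_zero_of_start he hα
  have hpos : 0 < (β.map (eval 1)) A := by
    rw [pos_iff_ne_zero]
    intro h0
    apply map_ne_zero' hβ 1
    rw [← Measure.measure_univ_eq_zero, ← union_compl_self A]
    exact measure_union_null h0 hβA
  obtain ⟨A1, hA1, hc, hp⟩ := hA.exists_lt_isClosed_of_ne_top (measure_ne_top _ _) hpos
  set β1 := β.restrict (eval 1 ⁻¹' A1) with hβ1
  have hβ1n : β1 ≠ 0 := restrict_ne_zero' hc.measurableSet hp.ne'
  have hβ1le : β1 ≤ β := Measure.restrict_le_self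
  obtain ⟨α1, hα1le, hα1⟩ := equalize (β := α) (measurable_eval' 0)
    ((Measure.map_mono hβ1le (measurable_eval' 0)).trans he.ge)
  have hα1n := ne_zero_of_start hα1.symm hβ1n
  have hα1A : (α1.map (eval 1)) A1 = 0 := map_ac hα1le 1 (measure_mono_null hA1 hαA)
  have hne : A1.Nonempty := by
    by_contra h
    rw [not_nonempty_iff_eq_empty] at h
    rw [h] at hp; simp at hp
  let E : ℕ → Set X := fun n => {x | 1 / ((n : ℝ) + 1) ≤ infDist x A1}
  have hE : ∀ n, MeasurableSet (E n) := fun n => measurableSet_le measurable_const measurable_infDist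
  obtain ⟨n, hn⟩ : ∃ n, (α1.map (eval 1)) (E n) ≠ 0 := by
    by_contra! hall
    apply map_ne_zero' hα1n 1
    have h1 := measure_iUnion_null hall
    rw [← Measure.measure_univ_eq_zero]
    refine measure_mono_null ?_ (measure_union_null hα1A h1)
    intro x _
    by_cases hx : x ∈ A1
    · exact Or.inl hx
    · right
      have := (hc.notMem_iff_infDist_pos hne).1 hx
      obtain ⟨n, hn⟩ := exists_nat_one_div_lt this
      exact mem_iUnion.2 ⟨n, hn.le⟩
  set α2 := α1.restrict (eval 1 ⁻¹' E n) with hα2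
  have hα2n : α2 ≠ 0 := restrict_ne_zero' (hE n) hn
  have hα2le : α2 ≤ α1 := Measure.restrict_le_self
  have : IsFiniteMeasure β1 := isFiniteMeasure_of_le β hβ1le
  obtain ⟨β2, hβ2le, hβ2⟩ := equalize (β := β1) (measurable_eval' 0)
    ((Measure.map_mono hα2le (measurable_eval' 0)).trans hα1.le)
  have hle : α2 + β2 ≤ α + β := add_le_add (hα2le.trans hα1le) (hβ2le.trans hβ1le)
  refine H.main3 hα2n (hF.mono hle) hR (hb.mono hle) hβ2.symm
    ((map_ac (hα2le.trans hα1le) 0).trans a0) hc ?_ (δ := 1 / ((n : ℝ) + 1)) (by positivity) ?_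
  · refine map_ac hβ2le 1 ?_
    rw [hβ1, map_restrict_eval _ _ hc.measurableSet, Measure.restrict_apply hc.measurableSet.compl]
    simp
  · have : {x | infDist x A1 < 1 / ((n : ℝ) + 1)} = (E n)ᶜ := by
      ext x; simp [E]
    rw [this, hα2, map_restrict_eval _ _ (hE n), Measure.restrict_apply (hE n).compl]
    simp

theorem Hyp.main (H : Hyp K N m) {π : Measure (Geo X)} (hF : FOpt π) (a0 : π.map (eval 0) ≪ m)
    {t : unitInterval} (ht : (t : ℝ) < 1) : π.map (eval t) ≪ m := by
  by_cases ht0 : (t : ℝ) = 0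
  · have : t = 0 := by ext; simpa using ht0
    rw [this]; exact a0
  have htp : 0 < (t : ℝ) := lt_of_le_of_ne t.2.1 (Ne.symm ht0)
  refine Measure.AbsolutelyContinuous.mk fun A hA hmA => ?_
  by_contra hpos
  obtain ⟨x₀⟩ := ‹Nonempty X›
  have : Nonempty X := ⟨x₀⟩
  have := hF.1
  have mev := measurable_eval' (X := X)
  let G : ℕ → Set (Geo X) := fun n => eval t ⁻¹' A ∩ (eval 0 ⁻¹' closedBall x₀ n ∩
    eval 1 ⁻¹' closedBall x₀ n)
  have hG : ∀ n, MeasurableSet (G n) := fun n => (mev t hA).inter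
    ((mev 0 measurableSet_closedBall).inter (mev 1 measurableSet_closedBall))
  obtain ⟨n, hn⟩ : ∃ n, π (G n) ≠ 0 := by
    by_contra! hall
    apply hpos
    rw [Measure.map_apply (mev t) hA]
    refine measure_mono_null ?_ (measure_iUnion_null hall)
    intro γ hγ
    obtain ⟨n, hn⟩ := exists_nat_ge (max (dist (eval 0 γ) x₀) (dist (eval 1 γ) x₀))
    exact mem_iUnion.2 ⟨n, hγ, (le_max_left _ _).trans hn, (le_max_right _ _).trans hn⟩
  set ω := π.restrict (G n) with hω
  have hωle : ω ≤ π := Measure.restrict_le_self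
  have hω0 : ω ≠ 0 := by
    intro hh
    apply hn
    have := congrArg (fun μ => μ univ) hh
    simpa [hω] using this
  have hnull : ∀ (r : unitInterval) (B : Set X), MeasurableSet B → (∀ γ ∈ G n, eval r γ ∈ B) →
      (ω.map (eval r)) Bᶜ = 0 := by
    intro r B hB h
    rw [Measure.map_apply (mev r) hB.compl]
    refine measure_eq_zero_iff_ae_notMem.2 ?_
    filter_upwards [ae_restrict_mem (hG n)] with γ hγ hh
    exact hh (h γ hγ)
  have hBd : Bd x₀ (3 * (n : ℝ)) ω := Bd.of_ends
    (hnull 0 _ measurableSet_closedBall fun γ hγ => hγ.2.1)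
    (hnull 1 _ measurableSet_closedBall fun γ hγ => hγ.2.2)
  have hωA := hnull t A hA fun γ hγ => hγ.1
  have hFω := hF.mono hωle
  have hF2 : FOpt (ω + ω) := by
    have := hFω.smul (c := 2) (by norm_num) (by norm_num)
    rwa [two_smul] at this
  have aω := (map_ac hωle 0).trans a0
  obtain ⟨α, β, p1, p2, p3, p4, p5, p6, p7, p8⟩ := H.J hω0 hF2 rfl aω hBd ht
  have hR : (0 : ℝ) ≤ 3 * (3 * n) := by positivity
  have hBd2 : Bd x₀ (3 * (3 * (n : ℝ))) (α + β) :=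
    p8.add ((hBd.mono p6).weaken (by have : (0 : ℝ) ≤ n := by positivity
                                     linarith))
  have hadd : α.map (reparam 0 t) + β.map (reparam 0 t) = (α + β).map (reparam 0 t) :=
    (Measure.map_add _ _ (measurable_reparam 0 t)).symm
  have hma : ∀ ζ : Measure (Geo X), (ζ.map (reparam 0 t)).map (eval 0) = ζ.map (eval 0) := by
    intro ζ; rw [map_eval_reparam, affI_zero]
  have hma1 : ∀ ζ : Measure (Geo X), (ζ.map (reparam 0 t)).map (eval 1) = ζ.map (eval t) := by
    intro ζ; rw [map_eval_reparam, affI_one]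
  refine H.main2 (α := α.map (reparam 0 t)) (β := β.map (reparam 0 t)) ?_
    (by rw [hadd]; exact p2.restr0 H.hCD htp) hR (by rw [hadd]; exact hBd2.map _ _)
    (by rw [hma, hma, p3])
    (by rw [hma]; exact (Measure.absolutelyContinuous_of_le p4).trans aω) hA ?_ ?_
  · intro hh
    apply map_ne_zero' p1 0
    rw [← hma, hh]; simp
  · rw [hma1]; exact map_ac p6 t hωA
  · rw [hma1]; exact p7 hmA

theorem cost_of_moments {μ ν : Measure X} (h1 : HasFiniteSecondMoment μ)
    (h2 : HasFiniteSecondMoment ν) {π : Measure (Geo X)} [IsFiniteMeasure π]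
    (e0 : π.map (eval 0) = μ) (e1 : π.map (eval 1) = ν) : transportCost π ≠ ⊤ := by
  obtain ⟨x, hx⟩ := h1
  obtain ⟨y, hy⟩ := h2
  rw [← e0, lintegral_map (by fun_prop) (measurable_eval' 0)] at hx
  rw [← e1, lintegral_map (by fun_prop) (measurable_eval' 1)] at hy
  have m0 := measurable_eval' (X := X) 0
  have m1 := measurable_eval' (X := X) 1
  have hle : transportCost π ≤ ∫⁻ γ, ((ENNReal.ofReal 3 * ENNReal.ofReal (dist (eval 0 γ) x ^ 2) +
      ENNReal.ofReal 3 * ENNReal.ofReal (dist (eval 1 γ) y ^ 2)) +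
      ENNReal.ofReal (3 * dist x y ^ 2)) ∂π := by
    refine lintegral_mono fun γ => ?_
    rw [← ENNReal.ofReal_mul (by norm_num), ← ENNReal.ofReal_mul (by norm_num),
      ← ENNReal.ofReal_add (by positivity) (by positivity),
      ← ENNReal.ofReal_add (by positivity) (by positivity)]
    apply ENNReal.ofReal_le_ofReal
    have t1 := dist_triangle4 (eval 0 γ) x y (eval 1 γ)
    rw [dist_comm y] at t1
    have : dist (eval 0 γ) (eval 1 γ) ^ 2 ≤
        (dist (eval 0 γ) x + dist x y + dist (eval 1 γ) y) ^ 2 :=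
      pow_le_pow_left₀ dist_nonneg t1 2
    nlinarith [sq_nonneg (dist (eval 0 γ) x - dist x y), sq_nonneg (dist (eval 1 γ) y - dist x y),
      sq_nonneg (dist (eval 0 γ) x - dist (eval 1 γ) y)]
  refine ne_top_of_le_ne_top ?_ hle
  rw [lintegral_add_right _ measurable_const, lintegral_add_left (by
    exact (((m0.dist measurable_const).pow_const 2).ennreal_ofReal).const_mul _),
    lintegral_const_mul' _ _ (by simp), lintegral_const_mul' _ _ (by simp), lintegral_const]
  finiteness
end P8

/-- **Corollary 1.6, first part**: interpolants from an absolutely continuous measure stay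
absolutely continuous for `t < 1`. -/
theorem interpolant_absolutelyContinuous
    [CompleteSpace X] [TopologicalSpace.SeparableSpace X] [ProperSpace X] [BorelSpace X]
    (hX : IsGeodesicSpace X) (m : Measure X)
    (hm_bdd : ∀ s : Set X, Bornology.IsBounded s → m s ≠ ⊤)
    (hm_supp : ∀ x : X, ∀ r : ℝ, 0 < r → 0 < m (ball x r))
    (K N : ℝ) (hN : 1 ≤ N) (hCD : IsCDStar K N m) (hGT : GoodTransport m)
    (μ ν : Measure X) (hμp : IsProbabilityMeasure μ) (hνp : IsProbabilityMeasure ν)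
    (hμ2 : HasFiniteSecondMoment μ) (hν2 : HasFiniteSecondMoment ν)
    (hμm : μ ≪ m)
    (π : Measure (Geo X)) (hπ : IsOptGeo μ ν π) :
    ∀ t : unitInterval, (t : ℝ) < 1 → π.map (eval t) ≪ m := by
  have : Nonempty X := by
    by_contra hne
    rw [not_nonempty_iff] at hne
    have h1 : μ univ = 1 := measure_univ
    rw [Set.univ_eq_empty_iff.2 hne] at h1
    simp at h1
  have : SecondCountableTopology X := UniformSpace.secondCountable_of_separable X
  have := hπ.1
  have H : Hyp K N m := ⟨hN, hCD, hGT, fun x R => hm_bdd _ isBounded_closedBall⟩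
  intro t ht
  exact H.main (hπ.fopt (cost_of_moments hμ2 hν2 hπ.2.1 hπ.2.2.1)) (by rw [hπ.2.1]; exact hμm) ht

end
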